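/- arXiv:1404.1298 — 3 statements merged into one kernel-verified Lean document; each statement's English description precedes it below -/
import Mathlib

section
/- Let S ⊆ ℝ² be a nice shape and let p, q, r ∈ ℝ² be three points that are not collinear. Then there exists exactly one S-range whose boundary contains all three points p, q and r. -/
open Set

noncomputable section

/-- The Euclidean plane. -/
abbrev Pt : Type := EuclideanSpace ℝ (Fin 2)

/-- `T` is an `S`-range: a homothetic copy of `S` with positive ratio. -/
def IsRange (S T : Set Pt) : Prop :=
  ∃ (c : ℝ) (v : Pt), 0 < c ∧ T = (fun x => c • x + v) '' S

/-- A straight line in the plane. -/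
def IsLine (l : Set Pt) : Prop :=
  ∃ (f : Pt →ₗ[ℝ] ℝ) (a : ℝ), f ≠ 0 ∧ l = {x | f x = a}

/-- A closed halfplane. -/
def IsClosedHalfplane (H : Set Pt) : Prop :=
  ∃ (f : Pt →ₗ[ℝ] ℝ) (a : ℝ), f ≠ 0 ∧ H = {x | f x ≤ a}

/-- An open halfplane bounded by the line through `p` and `q`. -/
def IsOpenHalfplaneOf (p q : Pt) (L : Set Pt) : Prop :=
  ∃ (f : Pt →ₗ[ℝ] ℝ) (a : ℝ), f ≠ 0 ∧ f p = a ∧ f q = a ∧ L = {x | a < f x}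

/-- `S` is a nice shape: a non-empty convex compact set such that every boundary
point has exactly one touching line and the boundary contains no non-trivial
straight line segment. -/
def NiceShape (S : Set Pt) : Prop :=
  S.Nonempty ∧ Convex ℝ S ∧ IsCompact S ∧
  (∀ p ∈ frontier S, ∃! l : Set Pt, IsLine l ∧ l ∩ S = {p}) ∧
  (∀ x ∈ frontier S, ∀ y ∈ frontier S, segment ℝ x y ⊆ frontier S → x = y)

/-- No four points of `A` lie on the boundary of a common `S`-range. -/
def NoFourOnBoundary (S A : Set Pt) : Prop :=
  ∀ T : Set Pt, IsRange S T →
    ∀ p₁ p₂ p₃ p₄ : Pt, p₁ ∈ A ∩ frontier T → p₂ ∈ A ∩ frontier T →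
      p₃ ∈ A ∩ frontier T → p₄ ∈ A ∩ frontier T →
      p₁ ≠ p₂ → p₁ ≠ p₃ → p₁ ≠ p₄ → p₂ ≠ p₃ → p₂ ≠ p₄ → p₃ ≠ p₄ → False

/-- `X` is in general position with respect to `S`: no two points on a vertical
line, no three points collinear, and no four points on the boundary of a common
`S`-range. -/
def GenPos (S : Set Pt) (X : Finset Pt) : Prop :=
  (∀ p ∈ X, ∀ q ∈ X, p ≠ q → p 0 ≠ q 0) ∧
  (∀ p ∈ X, ∀ q ∈ X, ∀ r ∈ X, p ≠ q → p ≠ r → q ≠ r →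
    ¬ Collinear ℝ ({p, q, r} : Set Pt)) ∧
  NoFourOnBoundary S ↑X

/-- The hyperedges of the `k`-uniform `S`-capturing hypergraph on `X`:
`k`-element subsets of `X` captured by some `S`-range. -/
def capturedSets (S : Set Pt) (X : Finset Pt) (k : ℕ) : Set (Set Pt) :=
  {Y | Y ⊆ ↑X ∧ Y.ncard = k ∧ ∃ T : Set Pt, IsRange S T ∧ ↑X ∩ T = Y}

/-- The `i`-sets of `X`: `i`-element subsets of `X` separable by a straight line,
i.e. captured by a closed halfplane.  `aᵢ` is the number of such sets. -/
def iSets (X : Finset Pt) (i : ℕ) : Set (Set Pt) :=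
  {Y | Y ⊆ ↑X ∧ Y.ncard = i ∧ ∃ H : Set Pt, IsClosedHalfplane H ∧ ↑X ∩ H = Y}

/-- `𝒜ᵢ`: closed halfplanes containing exactly `i` points of `X`, exactly two of
which lie on the boundary line. -/
def repHalfplanes (X : Finset Pt) (i : ℕ) : Set (Set Pt) :=
  {H | IsClosedHalfplane H ∧ ((↑X : Set Pt) ∩ H).ncard = i ∧
    ((↑X : Set Pt) ∩ frontier H).ncard = 2}

/-- `𝒮_pq`: the `S`-ranges having both `p` and `q` on their boundary. -/
def rangesThrough (S : Set Pt) (p q : Pt) : Set (Set Pt) :=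
  {T | IsRange S T ∧ p ∈ frontier T ∧ q ∈ frontier T}

/-- The ranges in `𝒮_pq` that come strictly after `S₁` (w.r.t. `≺`, i.e. inclusion
of the intersections with `L`) and have a point of `X` on their boundary that is
not on the boundary of `S₁`. -/
def nextCandidates (S : Set Pt) (p q : Pt) (L : Set Pt) (X : Finset Pt) (S₁ : Set Pt) :
    Set (Set Pt) :=
  {S₂ | S₂ ∈ rangesThrough S p q ∧ S₁ ∩ L ⊂ S₂ ∩ L ∧
    ((frontier S₂ \ frontier S₁) ∩ ↑X).Nonempty}

/-- `ℛ₁ᵏ`: Type I ranges, i.e. `S`-ranges containing exactly `k` points of `X`,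
exactly three of which are on the boundary. -/
def typeIRanges (S : Set Pt) (X : Finset Pt) (k : ℕ) : Set (Set Pt) :=
  {T | IsRange S T ∧ ((↑X : Set Pt) ∩ T).ncard = k ∧
    ((↑X : Set Pt) ∩ frontier T).ncard = 3}

/-- `ℛ(Y)`: the Type I representative ranges of `Y`. -/
def repRanges (S : Set Pt) (X : Finset Pt) (Y : Set Pt) : Set (Set Pt) :=
  {T | IsRange S T ∧ ↑X ∩ T = Y ∧ ((↑X : Set Pt) ∩ frontier T).ncard = 3}

/-- `ℰ₁ᵏ`: Type I hyperedges. -/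
def typeIEdges (S : Set Pt) (X : Finset Pt) (k : ℕ) : Set (Set Pt) :=
  {Y | Y ⊆ ↑X ∧ Y.ncard = k ∧ (repRanges S X Y).Nonempty}

/-- `ℰ₂ᵏ`: Type II hyperedges, captured by some `S`-range but by no `S`-range with
three points of `X` on its boundary. -/
def typeIIEdges (S : Set Pt) (X : Finset Pt) (k : ℕ) : Set (Set Pt) :=
  {Y | Y ∈ capturedSets S X k ∧ ¬ (repRanges S X Y).Nonempty}

section Separation

variable {E : Type*} [NormedAddCommGroup E] [NormedSpace ℝ E]

lemma IsOpen.exists_pos_add_smul_mem {U : Set E} (hU : IsOpen U) {z : E} (hz : z ∈ U) (v : E) :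
    ∃ ε : ℝ, 0 < ε ∧ z + ε • v ∈ U := by
  have hc : Continuous fun ε : ℝ => z + ε • v := by fun_prop
  obtain ⟨ε, hε, hb⟩ := Metric.isOpen_iff.1 (hU.preimage hc) 0 (by simpa using hz)
  refine ⟨ε / 2, by positivity, hb ?_⟩
  rw [Metric.mem_ball, dist_zero_right, Real.norm_of_nonneg (by positivity)]
  linarith

/-- A nonzero functional does not attain its maximum over a set in the interior. -/
lemma lt_of_mem_interior_of_le {S : Set E} {f : StrongDual ℝ E} (hf : f ≠ 0) {c : ℝ}
    (hc : ∀ y ∈ S, f y ≤ c) {z : E} (hz : z ∈ interior S) : f z < c := by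
  obtain ⟨v, hv⟩ : ∃ v, f v ≠ 0 := by
    by_contra! hcon
    exact hf (ContinuousLinearMap.ext hcon)
  obtain ⟨ε, hε, hm⟩ := isOpen_interior.exists_pos_add_smul_mem hz (f v • v)
  have h1 := hc _ (interior_subset hm)
  simp only [map_add, map_smul, smul_eq_mul] at h1
  have : 0 < ε * (f v * f v) := mul_pos hε (mul_self_pos.2 hv)
  linarith

/-- A preconnected set meeting both a closed set and its complement meets its frontier. -/
lemma IsPreconnected.exists_mem_frontier {X : Type*} [TopologicalSpace X] {A S : Set X}
    (hA : IsPreconnected A) (hS : IsClosed S) (h₁ : (A ∩ S).Nonempty) (h₂ : (A ∩ Sᶜ).Nonempty) :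
    (A ∩ frontier S).Nonempty := by
  by_contra hcon
  have hint : ∀ x ∈ A, x ∈ S → x ∈ interior S := fun x hx hxS => by
    by_contra hxi
    exact hcon ⟨x, hx, by rw [hS.frontier_eq]; exact ⟨hxS, hxi⟩⟩
  obtain ⟨y, hyA, hyS⟩ := h₁
  obtain ⟨z, -, hz₁, hz₂⟩ := hA (interior S) Sᶜ isOpen_interior hS.isOpen_compl
    (fun x hx => (em (x ∈ S)).imp (hint x hx) id) ⟨y, hyA, hint y hyA hyS⟩ h₂
  exact hz₂ (interior_subset hz₁)

/-- Points of a compact set that almost minimize a functional are close to its unique minimizer. -/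
lemma IsCompact.exists_pos_forall_lt_mem {S U : Set E} (hS : IsCompact S) (hU : IsOpen U)
    (h : StrongDual ℝ E) {x : E} (hxU : x ∈ U) (hx : ∀ y ∈ S, y ≠ x → h x < h y) :
    ∃ δ : ℝ, 0 < δ ∧ ∀ y ∈ S, h y < h x + δ → y ∈ U := by
  rcases (S \ U).eq_empty_or_nonempty with he | hne
  · exact ⟨1, one_pos, fun y hy _ => sdiff_eq_empty.1 he hy⟩
  · obtain ⟨m, hm, hmin⟩ := (hS.diff hU).exists_isMinOn hne h.continuous.continuousOn
    refine ⟨h m - h x, sub_pos.2 (hx m hm.1 fun hmx => hm.2 (hmx ▸ hxU)), fun y hy hlt => ?_⟩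
    by_contra hyU
    have : h m ≤ h y := hmin ⟨hy, hyU⟩
    linarith

/-- The minimizers of `k` over the slices of a compact convex set by the level sets of `h`. -/
lemma exists_slice_minimizer {S : Set E} (hconv : Convex ℝ S) (hcomp : IsCompact S)
    (h k : StrongDual ℝ E) {x y : E} (hx : x ∈ S) (hy : y ∈ S) :
    ∃ a : ℝ → E, (∀ t ∈ Icc (h x) (h y),
        a t ∈ S ∧ h (a t) = t ∧ ∀ z ∈ S, h z = t → k (a t) ≤ k z) ∧
      ContinuousOn (fun t => k (a t)) (Ioo (h x) (h y)) := by
  have key : ∀ t ∈ Icc (h x) (h y),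
      ∃ a, a ∈ S ∧ h a = t ∧ ∀ z ∈ S, h z = t → k a ≤ k z := fun t ht => by
    have hne : (S ∩ h ⁻¹' {t}).Nonempty := by
      obtain ⟨z, hz, hzt⟩ :=
        hconv.isPreconnected.intermediate_value hx hy h.continuous.continuousOn ht
      exact ⟨z, hz, hzt⟩
    obtain ⟨a, ha, hmin⟩ := (hcomp.inter_right
      (isClosed_singleton.preimage h.continuous)).exists_isMinOn hne k.continuous.continuousOn
    exact ⟨a, ha.1, ha.2, fun z hz hzt => hmin ⟨hz, hzt⟩⟩
  choose! a ha using key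
  refine ⟨a, ha, ConvexOn.continuousOn isOpen_Ioo ⟨convex_Ioo _ _, ?_⟩⟩
  intro s hs t ht α β hα hβ hαβ
  obtain ⟨hsS, hst, -⟩ := ha s (Ioo_subset_Icc_self hs)
  obtain ⟨htS, htt, -⟩ := ha t (Ioo_subset_Icc_self ht)
  have := (ha _ (Ioo_subset_Icc_self (convex_Ioo _ _ hs ht hα hβ hαβ))).2.2
    (α • a s + β • a t) (hconv hsS htS hα hβ hαβ) (by simp [hst, htt])
  simpa using this

end Separation

namespace NiceShape

variable {S : Set Pt}

lemma isLine_of_ne_zero {f : StrongDual ℝ Pt} (hf : f ≠ 0) (c : ℝ) : IsLine {x | f x = c} :=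
  ⟨f.toLinearMap, c, fun h0 => hf (ContinuousLinearMap.ext fun x => LinearMap.congr_fun h0 x), rfl⟩

lemma interior_nonempty (hS : NiceShape S) : (interior S).Nonempty := by
  obtain ⟨⟨x, hx⟩, hconv, hcomp, htan, hseg⟩ := hS
  by_contra hne
  rw [not_nonempty_iff_eq_empty] at hne
  have hfr : frontier S = S := by rw [hcomp.isClosed.frontier_eq, hne, sdiff_empty]
  rw [hfr] at htan hseg
  have hSx : S = {x} := eq_singleton_iff_unique_mem.2
    ⟨hx, fun y hy => hseg y hy x hx (hconv.segment_subset hy hx)⟩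
  have htouch : ∀ i : Fin 2, IsLine {y : Pt | EuclideanSpace.proj (𝕜 := ℝ) i y = x i} ∧
      {y : Pt | EuclideanSpace.proj (𝕜 := ℝ) i y = x i} ∩ S = {x} := fun i => by
    refine ⟨isLine_of_ne_zero (fun h0 => ?_) _, ?_⟩
    · simpa using DFunLike.congr_fun h0 (EuclideanSpace.single i (1 : ℝ))
    · rw [hSx, inter_eq_right, singleton_subset_iff]
      rfl
  have hlines := (htan x hx).unique (htouch 0) (htouch 1)
  have hmem : x + EuclideanSpace.single 0 1 ∈
      {y : Pt | EuclideanSpace.proj (𝕜 := ℝ) (1 : Fin 2) y = x 1} := by simp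
  rw [← hlines] at hmem
  simp at hmem

/-- A supporting line of a nice shape touches it in a single point. -/
lemma lt_of_support (hS : NiceShape S) {f : StrongDual ℝ Pt} (hf : f ≠ 0) {x : Pt} (hx : x ∈ S)
    (hle : ∀ y ∈ S, f y ≤ f x) {y : Pt} (hy : y ∈ S) (hyx : y ≠ x) : f y < f x := by
  obtain ⟨-, hconv, hcomp, -, hseg⟩ := hS
  refine lt_of_le_of_ne (hle y hy) fun heq => hyx ?_
  have hsub : segment ℝ y x ⊆ frontier S := by
    intro z hz
    have hfz : f z = f x := by
      obtain ⟨a, b, -, -, hab, rfl⟩ := hz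
      simp only [map_add, map_smul, smul_eq_mul, heq]
      rw [← add_mul, hab, one_mul]
    rw [hcomp.isClosed.frontier_eq]
    exact ⟨hconv.segment_subset hy hx hz,
      fun hzi => (lt_of_mem_interior_of_le hf hle hzi).ne hfz⟩
  exact hseg y (hsub (left_mem_segment ..)) x (hsub (right_mem_segment ..)) hsub

lemma exists_strict_support (hS : NiceShape S) {x : Pt} (hx : x ∈ frontier S) :
    ∃ f : StrongDual ℝ Pt, ∀ y ∈ S, y ≠ x → f y < f x := by
  have hcl := hS.2.2.1.isClosed
  rw [hcl.frontier_eq] at hx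
  obtain ⟨f, hf, hle⟩ :=
    geometric_hahn_banach_of_nonempty_interior_point hS.2.1 hx.2 hS.interior_nonempty
  exact ⟨f, fun y hy hyx => hS.lt_of_support hf hx.1 hle hy hyx⟩

/-- At a point where `h` is minimal, every direction along which `h` increases enters
the interior of a nice shape. -/
lemma exists_add_smul_mem_interior (hS : NiceShape S) {h : StrongDual ℝ Pt} {x e : Pt}
    (hx : x ∈ S) (hmin : ∀ y ∈ S, h x ≤ h y) (he : 0 < h e) :
    ∃ ε : ℝ, 0 < ε ∧ x + ε • e ∈ interior S := by
  by_contra! hcon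
  have hh : -h ≠ 0 := by
    rw [neg_ne_zero]
    rintro rfl
    simp at he
  have hmin' : ∀ y ∈ S, (-h) y ≤ (-h) x := fun y hy => neg_le_neg (hmin y hy)
  obtain ⟨z, hz⟩ := hS.interior_nonempty
  have hray : Convex ℝ ((fun ε : ℝ => x + ε • e) '' Ioi 0) := by
    have := ((convex_Ioi (𝕜 := ℝ) (0 : ℝ)).is_linear_image (f := fun ε : ℝ => ε • e)
      ⟨fun _ _ => add_smul .., fun c ε => smul_assoc c ε e⟩).translate x
    rwa [image_image] at this
  obtain ⟨g, c, hg, hgS, hgray⟩ := geometric_hahn_banach_of_nonempty_interior hS.2.1 hray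
    (by
      rw [disjoint_right]
      rintro _ ⟨ε, hε, rfl⟩
      exact hcon ε hε) hS.interior_nonempty ((nonempty_Ioi).image _)
  have hgray' : ∀ ε : ℝ, 0 < ε → c ≤ g x + ε * g e := fun ε hε => by
    simpa using hgray _ (mem_image_of_mem _ hε)
  have hgx : g x = c := by
    refine le_antisymm (hgS x hx) ?_
    have hlim : Filter.Tendsto (fun ε : ℝ => g x + ε * g e) (nhdsWithin 0 (Ioi 0))
        (nhds (g x + 0 * g e)) :=
      ((by fun_prop : Continuous fun ε : ℝ => g x + ε * g e).tendsto 0).mono_left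
        nhdsWithin_le_nhds
    rw [zero_mul, add_zero] at hlim
    exact ge_of_tendsto hlim (eventually_mem_nhdsWithin.mono hgray')
  have hge : 0 ≤ g e := by have := hgray' 1 one_pos; linarith
  rw [← hgx] at hgS
  have hxf : x ∈ frontier S := by
    rw [hS.2.2.1.isClosed.frontier_eq]
    exact ⟨hx, fun hxi => (lt_of_mem_interior_of_le hg hgS hxi).ne rfl⟩
  have htouch : ∀ f : StrongDual ℝ Pt, f ≠ 0 → (∀ y ∈ S, f y ≤ f x) →
      {y | f y = f x} ∩ S = {x} := fun f hf hle => by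
    ext y
    simp only [mem_inter_iff, mem_ofPred_eq, mem_singleton_iff]
    constructor
    · rintro ⟨hy, hyS⟩
      by_contra hyx
      exact (hS.lt_of_support hf hx hle hyS hyx).ne hy
    · rintro rfl
      exact ⟨rfl, hx⟩
  have hlines : {y | (-h) y = (-h) x} = {y | g y = g x} :=
    (hS.2.2.2.1 x hxf).unique ⟨isLine_of_ne_zero hh _, htouch _ hh hmin'⟩
      ⟨isLine_of_ne_zero hg _, htouch _ hg hgS⟩
  have hgz := lt_of_mem_interior_of_le hg hgS hz
  have hhz := lt_of_mem_interior_of_le hh hmin' hz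
  simp only [neg_apply, neg_lt_neg_iff] at hhz
  have hmem : z - ((h z - h x) / h e) • e ∈ {y | (-h) y = (-h) x} := by
    simp only [mem_ofPred_eq, neg_apply, map_sub, map_smul, smul_eq_mul]
    field_simp
    ring
  rw [hlines] at hmem
  simp only [mem_ofPred_eq, map_sub, map_smul, smul_eq_mul] at hmem
  have : 0 ≤ (h z - h x) / h e * g e := mul_nonneg (div_nonneg (by linarith) he.le) hge
  linarith

/-- A nice shape has an inscribed triangle with edge directions `u` and `e` and the ratio of
the corresponding edges prescribed. -/
lemma exists_inscribed_triangle (hS : NiceShape S) {u e : Pt} {k h : StrongDual ℝ Pt}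
    (hku : k u = 1) (hhu : h u = 0) (hhe : h e = 1)
    (hdec : ∀ z, k z • u + h z • e = z) :
    ∃ (a : Pt) (l : ℝ), 0 < l ∧ a ∈ frontier S ∧ a + l • u ∈ frontier S ∧
      a + l • e ∈ frontier S := by
  have hconv := hS.2.1
  have hcomp := hS.2.2.1
  have hcl := hcomp.isClosed
  have hh : h ≠ 0 := by rintro rfl; simp at hhe
  obtain ⟨x, hx, hxmin⟩ := hcomp.exists_isMinOn hS.1 h.continuous.continuousOn
  obtain ⟨y, hy, hymax⟩ := hcomp.exists_isMaxOn hS.1 h.continuous.continuousOn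
  have hxmin : ∀ z ∈ S, h x ≤ h z := fun z hz => hxmin hz
  have hymax : ∀ z ∈ S, h z ≤ h y := fun z hz => hymax hz
  have hxs : ∀ z ∈ S, z ≠ x → h x < h z := fun z hz hzx => by
    have := hS.lt_of_support (neg_ne_zero.2 hh) hx (fun w hw => neg_le_neg (hxmin w hw)) hz hzx
    simpa using this
  have hys : ∀ z ∈ S, z ≠ y → h z < h y := fun z hz hzy => hS.lt_of_support hh hy hymax hz hzy
  have hxy : h x < h y := by
    obtain ⟨z, hz⟩ := hS.interior_nonempty
    exact (hxmin z (interior_subset hz)).trans_lt (lt_of_mem_interior_of_le hh hymax hz)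
  obtain ⟨a, ha, hac⟩ := exists_slice_minimizer hconv hcomp h k hx hy
  obtain ⟨b, hb, hbc⟩ := exists_slice_minimizer hconv hcomp h (-k) hx hy
  have haf : ∀ t ∈ Ioo (h x) (h y), a t ∈ frontier S := fun t ht => by
    obtain ⟨haS, hat, hamin⟩ := ha t (Ioo_subset_Icc_self ht)
    rw [hcl.frontier_eq]
    refine ⟨haS, fun hai => ?_⟩
    obtain ⟨ε, hε, hm⟩ := isOpen_interior.exists_pos_add_smul_mem hai (-u)
    have := hamin _ (interior_subset hm) (by simp [hhu, hat])
    simp [hku] at this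
    linarith
  have hbf : ∀ t ∈ Ioo (h x) (h y), b t ∈ frontier S := fun t ht => by
    obtain ⟨hbS, hbt, hbmin⟩ := hb t (Ioo_subset_Icc_self ht)
    rw [hcl.frontier_eq]
    refine ⟨hbS, fun hbi => ?_⟩
    obtain ⟨ε, hε, hm⟩ := isOpen_interior.exists_pos_add_smul_mem hbi u
    have := hbmin _ (interior_subset hm) (by simp [hhu, hbt])
    simp [hku] at this
    linarith
  set l : ℝ → ℝ := fun t => k (b t) - k (a t) with hl
  have hab : ∀ t ∈ Ioo (h x) (h y), a t + l t • u = b t := fun t ht => by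
    rw [← hdec (a t), ← hdec (b t), (ha t (Ioo_subset_Icc_self ht)).2.1,
      (hb t (Ioo_subset_Icc_self ht)).2.1, hl]
    module
  have hlpos : ∀ t ∈ Ioo (h x) (h y), 0 < l t := fun t ht => by
    obtain ⟨haS, hat, hamin⟩ := ha t (Ioo_subset_Icc_self ht)
    obtain ⟨hbS, hbt, hbmin⟩ := hb t (Ioo_subset_Icc_self ht)
    have hle : 0 ≤ l t := by
      have := hbmin _ haS hat
      simp at this
      exact sub_nonneg.2 this
    refine lt_of_le_of_ne hle fun h0 => ?_
    -- if the slice is a single point, that point lies on the segment from `x` to `y`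
    set s := (t - h x) / (h y - h x) with hs
    have hd : 0 < h y - h x := sub_pos.2 hxy
    have hs0 : 0 < s := div_pos (sub_pos.2 ht.1) hd
    have hs1 : s < 1 := (div_lt_one hd).2 (by linarith [ht.2])
    have hst : s * (h y - h x) = t - h x := div_mul_cancel₀ _ hd.ne'
    have hmS : (1 - s) • x + s • y ∈ S := hconv hx hy (by linarith) hs0.le (by ring)
    have hmt : h ((1 - s) • x + s • y) = t := by simp; linarith
    have hm1 := hamin _ hmS hmt
    have hm2 := hbmin _ hmS hmt
    simp only [neg_apply, neg_le_neg_iff] at hm2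
    have hma : (1 - s) • x + s • y = a t := by
      rw [← hdec ((1 - s) • x + s • y), ← hdec (a t), hmt, hat,
        le_antisymm (hm2.trans (by simp only [hl] at h0; linarith)) hm1]
    obtain ⟨f, hf⟩ := hS.exists_strict_support (haf t ht)
    have hfx := hf x hx (by rintro h1; rw [← hat, ← h1] at ht; exact ht.1.false)
    have hfy := hf y hy (by rintro h1; rw [← hat, ← h1] at ht; exact ht.2.false)
    have hfa : (1 - s) * f x + s * f y = f (a t) := by rw [← hma]; simp
    nlinarith
  have hR : ContinuousOn (fun t => a t + l t • e) (Ioo (h x) (h y)) := by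
    have hlc : ContinuousOn l (Ioo (h x) (h y)) := by
      refine (hbc.neg.sub hac).congr fun t _ => ?_
      simp [hl]
    have ha' : ContinuousOn a (Ioo (h x) (h y)) := by
      have : ContinuousOn (fun t => k (a t) • u + t • e) (Ioo (h x) (h y)) :=
        (hac.smul continuousOn_const).add (continuousOn_id.smul continuousOn_const)
      refine this.congr fun t ht => ?_
      have := hdec (a t)
      rw [(ha t (Ioo_subset_Icc_self ht)).2.1] at this
      exact this.symm
    exact ha'.add (hlc.smul continuousOn_const)
  have hlow : ((fun t => a t + l t • e) '' Ioo (h x) (h y) ∩ S).Nonempty := by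
    obtain ⟨ε, hε, hmem⟩ := hS.exists_add_smul_mem_interior hx hxmin (e := e) (by simp [hhe])
    have hU : IsOpen ({z | z + ε • e ∈ interior S} ∩ {z | |k z - k x| < ε / 2}) :=
      (isOpen_interior.preimage (by fun_prop : Continuous fun z : Pt => z + ε • e)).inter
        (isOpen_lt (by fun_prop) continuous_const)
    obtain ⟨δ, hδ, hnear⟩ := hcomp.exists_pos_forall_lt_mem hU h ⟨hmem, by simpa using hε⟩ hxs
    obtain ⟨t, ht1, ht2⟩ := exists_between (lt_min hxy (lt_add_of_pos_right (h x) hδ))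
    have ht : t ∈ Ioo (h x) (h y) := ⟨ht1, ht2.trans_le (min_le_left _ _)⟩
    have htδ := ht2.trans_le (min_le_right _ _)
    obtain ⟨haS, hat, -⟩ := ha t (Ioo_subset_Icc_self ht)
    obtain ⟨hbS, hbt, -⟩ := hb t (Ioo_subset_Icc_self ht)
    obtain ⟨haε, hak⟩ := hnear _ haS (by rwa [hat])
    obtain ⟨-, hbk⟩ := hnear _ hbS (by rwa [hbt])
    simp only [mem_ofPred_eq, abs_lt] at haε hak hbk
    have hlε : l t < ε := by simp only [hl]; linarith
    refine ⟨_, mem_image_of_mem _ ht, ?_⟩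
    have := hconv haS (interior_subset haε) (a := 1 - l t / ε) (b := l t / ε)
      (sub_nonneg.2 ((div_le_one hε).2 hlε.le)) (div_nonneg (hlpos t ht).le hε.le) (by ring)
    convert this using 1
    have : l t = l t / ε * ε := (div_mul_cancel₀ _ hε.ne').symm
    rw [smul_add, smul_smul, ← this]
    module
  have hhigh : ((fun t => a t + l t • e) '' Ioo (h x) (h y) ∩ Sᶜ).Nonempty := by
    obtain ⟨ε, hε, hmem⟩ := hS.exists_add_smul_mem_interior (h := -h) (e := -e) hy
      (fun z hz => neg_le_neg (hymax z hz)) (by simp [hhe])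
    obtain ⟨δ, hδ, hnear⟩ := hcomp.exists_pos_forall_lt_mem
      (isOpen_interior.preimage (by fun_prop : Continuous fun z : Pt => z + ε • -e)) (-h) hmem
      (fun z hz hzy => neg_lt_neg (hys z hz hzy))
    obtain ⟨t, ht1, ht2⟩ := exists_between (max_lt hxy (sub_lt_self (h y) hδ))
    have ht : t ∈ Ioo (h x) (h y) := ⟨(le_max_left _ _).trans_lt ht1, ht2⟩
    have htδ := (le_max_right _ _).trans_lt ht1
    obtain ⟨haS, hat, -⟩ := ha t (Ioo_subset_Icc_self ht)
    have haε : a t + ε • -e ∈ interior S := hnear _ haS (by simp [hat]; linarith)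
    refine ⟨_, mem_image_of_mem _ ht, fun hRS => ?_⟩
    have hlt := hlpos t ht
    have hsum : 0 < l t + ε := by positivity
    have := hconv.openSegment_interior_self_subset_interior haε hRS
      ⟨l t / (l t + ε), ε / (l t + ε), by positivity, by positivity, by field_simp, rfl⟩
    have heq : (l t / (l t + ε)) • (a t + ε • -e) + (ε / (l t + ε)) • (a t + l t • e) = a t := by
      match_scalars <;> field_simp
      ring
    rw [heq] at this
    have hfr := haf t ht
    rw [hcl.frontier_eq] at hfr
    exact hfr.2 this
  obtain ⟨_, ⟨t, ht, rfl⟩, hfr⟩ :=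
    (isPreconnected_Ioo.image _ hR).exists_mem_frontier hcl hlow hhigh
  exact ⟨a t, l t, hlpos t ht, haf t ht, by rw [hab t ht]; exact hbf t ht, hfr⟩

/-- If a frontier point is a convex combination of points of the shape, all points of positive
weight coincide with it. -/
lemma eq_of_combination (hS : NiceShape S) {x a b c : Pt} (hx : x ∈ frontier S) (ha : a ∈ S)
    (hb : b ∈ S) (hc : c ∈ S) {α β γ : ℝ} (hα : 0 ≤ α) (hβ : 0 ≤ β) (hγ : 0 ≤ γ)
    (heq : α • a + β • b + γ • c = (α + β + γ) • x) :
    (α = 0 ∨ a = x) ∧ (β = 0 ∨ b = x) ∧ (γ = 0 ∨ c = x) := by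
  obtain ⟨f, hf⟩ := hS.exists_strict_support hx
  have hle : ∀ z ∈ S, 0 ≤ f x - f z := fun z hz => by
    rcases eq_or_ne z x with rfl | hzx
    · simp
    · linarith [hf z hz hzx]
  have hz : ∀ z ∈ S, ∀ ω : ℝ, ω * (f x - f z) = 0 → ω = 0 ∨ z = x := fun z hz ω h0 =>
    (mul_eq_zero.1 h0).imp id fun h1 => by
      by_contra hzx
      linarith [hf z hz hzx]
  have h0 := congrArg f heq
  simp only [map_add, map_smul, smul_eq_mul] at h0
  have h1 := mul_nonneg hα (hle a ha)
  have h2 := mul_nonneg hβ (hle b hb)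
  have h3 := mul_nonneg hγ (hle c hc)
  exact ⟨hz a ha α (by linarith), hz b hb β (by linarith), hz c hc γ (by linarith)⟩

/-- Two positively homothetic triangles inscribed in a nice shape coincide, provided two of the
barycentric weights of their center of homothety are nonnegative. -/
lemma homothety_unique_of_nonneg (hS : NiceShape S) {p q r w₁ w₂ : Pt} {l₁ l₂ α β γ : ℝ}
    (hpq : p ≠ q) (hqr : q ≠ r) (hl₁ : 0 < l₁) (hl₂ : 0 < l₂)
    (hp₁ : l₁ • p + w₁ ∈ frontier S) (hq₁ : l₁ • q + w₁ ∈ frontier S)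
    (hr₁ : l₁ • r + w₁ ∈ frontier S) (hp₂ : l₂ • p + w₂ ∈ frontier S)
    (hq₂ : l₂ • q + w₂ ∈ frontier S)
    (hα : 0 ≤ α) (hγ : 0 ≤ γ) (hsum : α + β + γ = l₂ - l₁)
    (hcomb : α • p + β • q + γ • r = w₁ - w₂) : l₁ = l₂ ∧ w₁ = w₂ := by
  have hsub : frontier S ⊆ S := hS.2.2.1.isClosed.frontier_subset
  have hinj : ∀ {l : ℝ} {w x y : Pt}, 0 < l → l • x + w = l • y + w → x = y :=
    fun hl hxy => smul_right_injective Pt hl.ne' (add_right_cancel hxy)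
  obtain rfl : β = l₂ - l₁ - α - γ := by linarith
  have hkey : α • (l₁ • p + w₁) + γ • (l₁ • r + w₁) + l₁ • (l₂ • q + w₂) =
      (α + γ + l₁) • (l₁ • q + w₁) := by
    obtain rfl : w₂ = w₁ - (α • p + (l₂ - l₁ - α - γ) • q + γ • r) := by rw [hcomb]; abel
    module
  obtain ⟨h1, h2, -⟩ :=
    hS.eq_of_combination hq₁ (hsub hp₁) (hsub hr₁) (hsub hq₂) hα hγ hl₁.le hkey
  obtain rfl : α = 0 := h1.resolve_right fun hc => hpq (hinj hl₁ hc)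
  obtain rfl : γ = 0 := h2.resolve_right fun hc => hqr (hinj hl₁ hc).symm
  have hw : w₂ = w₁ - (l₂ - l₁) • q := by
    rw [eq_sub_iff_add_eq, ← eq_sub_iff_add_eq', ← hcomb]
    module
  rcases lt_trichotomy l₁ l₂ with hlt | rfl | hlt
  · obtain ⟨-, h4, -⟩ := hS.eq_of_combination hp₁ (hsub hp₁) (hsub hq₁) (hsub hp₂)
      (α := 0) (β := l₂ - l₁) (γ := l₁) le_rfl (by linarith) hl₁.le (by rw [hw]; module)
    rcases h4 with h4 | h4
    · linarith
    · exact absurd (hinj hl₁ h4).symm hpq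
  · exact ⟨rfl, by rw [hw]; simp⟩
  · obtain ⟨-, h4, -⟩ := hS.eq_of_combination hp₂ (hsub hp₂) (hsub hq₂) (hsub hp₁)
      (α := 0) (β := l₁ - l₂) (γ := l₂) le_rfl (by linarith) hl₂.le (by rw [hw]; module)
    rcases h4 with h4 | h4
    · linarith
    · exact absurd (hinj hl₂ h4).symm hpq

/-- Two positively homothetic nondegenerate triangles inscribed in a nice shape coincide. -/
lemma homothety_unique (hS : NiceShape S) {p q r w₁ w₂ : Pt} {l₁ l₂ : ℝ}
    {k h : StrongDual ℝ Pt} (hdec : ∀ z, k z • (q - p) + h z • (r - p) = z)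
    (hpq : p ≠ q) (hqr : q ≠ r) (hpr : p ≠ r) (hl₁ : 0 < l₁) (hl₂ : 0 < l₂)
    (hp₁ : l₁ • p + w₁ ∈ frontier S) (hq₁ : l₁ • q + w₁ ∈ frontier S)
    (hr₁ : l₁ • r + w₁ ∈ frontier S) (hp₂ : l₂ • p + w₂ ∈ frontier S)
    (hq₂ : l₂ • q + w₂ ∈ frontier S) (hr₂ : l₂ • r + w₂ ∈ frontier S) : l₁ = l₂ ∧ w₁ = w₂ := by
  obtain ⟨α, β, γ, hsum, hcomb⟩ : ∃ α β γ : ℝ, α + β + γ = l₂ - l₁ ∧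
      α • p + β • q + γ • r = w₁ - w₂ := by
    set z := w₁ - w₂ - (l₂ - l₁) • p with hz
    refine ⟨l₂ - l₁ - k z - h z, k z, h z, by ring, ?_⟩
    have hp : (l₂ - l₁) • p + (k z • (q - p) + h z • (r - p)) = w₁ - w₂ := by
      rw [hdec, hz]
      abel
    rw [← hp]
    module
  have hsum' : -α + -β + -γ = l₁ - l₂ := by linarith
  have hcomb' : -α • p + -β • q + -γ • r = w₂ - w₁ := by rw [← neg_sub w₁, ← hcomb]; module
  have hcomm : ∀ {a b c : ℝ} {w : Pt} (x y z : Pt), a • x + b • y + c • z = w →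
      a • x + c • z + b • y = w ∧ b • y + a • x + c • z = w := fun x y z hw =>
    ⟨by rw [← hw]; abel, by rw [← hw]; abel⟩
  rcases le_total 0 α with hα | hα
  · rcases le_total 0 γ with hγ | hγ
    · exact hS.homothety_unique_of_nonneg hpq hqr hl₁ hl₂ hp₁ hq₁ hr₁ hp₂ hq₂ hα hγ hsum hcomb
    · rcases le_total 0 β with hβ | hβ
      · exact hS.homothety_unique_of_nonneg hpr hqr.symm hl₁ hl₂ hp₁ hr₁ hq₁ hp₂ hr₂ hα hβ
          (by linarith) (hcomm _ _ _ hcomb).1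
      · exact (hS.homothety_unique_of_nonneg hpq.symm hpr hl₂ hl₁ hq₂ hp₂ hr₂ hq₁ hp₁
          (neg_nonneg.2 hβ) (neg_nonneg.2 hγ) (by linarith) (hcomm _ _ _ hcomb').2).imp
            Eq.symm Eq.symm
  · rcases le_total 0 γ with hγ | hγ
    · rcases le_total 0 β with hβ | hβ
      · exact hS.homothety_unique_of_nonneg hpq.symm hpr hl₁ hl₂ hq₁ hp₁ hr₁ hq₂ hp₂ hβ hγ
          (by linarith) (hcomm _ _ _ hcomb).2
      · exact (hS.homothety_unique_of_nonneg hpr hqr.symm hl₂ hl₁ hp₂ hr₂ hq₂ hp₁ hr₁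
          (neg_nonneg.2 hα) (neg_nonneg.2 hβ) (by linarith) (hcomm _ _ _ hcomb').1).imp
            Eq.symm Eq.symm
    · exact (hS.homothety_unique_of_nonneg hpq hqr hl₂ hl₁ hp₂ hq₂ hr₂ hp₁ hq₁
        (neg_nonneg.2 hα) (neg_nonneg.2 hγ) hsum' hcomb').imp Eq.symm Eq.symm

end NiceShape

lemma mem_frontier_homothety_iff {S : Set Pt} {c : ℝ} (hc : 0 < c) (v x : Pt) :
    x ∈ frontier ((fun x => c • x + v) '' S) ↔ c⁻¹ • x + -(c⁻¹ • v) ∈ frontier S := by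
  let φ : Pt ≃ₜ Pt := (Homeomorph.smulOfNeZero c hc.ne').trans (Homeomorph.addRight v)
  have hφ : (fun x : Pt => c • x + v) = φ := rfl
  have hx : x = φ (c⁻¹ • x + -(c⁻¹ • v)) := by
    rw [← hφ]
    simp [smul_add, smul_smul, hc.ne']
  rw [hφ, ← φ.image_frontier]
  conv_lhs => rw [hx]
  exact φ.injective.mem_set_image

/-- Coordinate functionals for the edge vectors of a nondegenerate triangle. -/
lemma exists_coord_of_not_collinear {p q r : Pt} (h : ¬ Collinear ℝ ({p, q, r} : Set Pt)) :
    ∃ k g : StrongDual ℝ Pt, k (q - p) = 1 ∧ g (q - p) = 0 ∧ g (r - p) = 1 ∧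
      ∀ z, k z • (q - p) + g z • (r - p) = z := by
  have hli : LinearIndependent ℝ ![q - p, r - p] := by
    by_contra hdep
    refine h ((collinear_iff_of_mem (mem_insert p _)).2 ?_)
    rw [LinearIndependent.pair_iff] at hdep
    push Not at hdep
    obtain ⟨s, t, hst, hne⟩ := hdep
    rcases eq_or_ne s 0 with rfl | hs
    · have hr : r - p = 0 := by simpa [hne rfl] using hst
      refine ⟨q - p, fun x hx => ?_⟩
      rcases hx with rfl | rfl | rfl
      · exact ⟨0, by simp⟩
      · exact ⟨1, by simp⟩
      · exact ⟨0, by simpa using sub_eq_zero.1 hr⟩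
    · refine ⟨r - p, fun x hx => ?_⟩
      rcases hx with rfl | rfl | rfl
      · exact ⟨0, by simp⟩
      · refine ⟨-(s⁻¹ * t), ?_⟩
        have hq : x - p = -(s⁻¹ * t) • (r - p) := by
          rw [neg_smul, mul_smul, eq_neg_of_add_eq_zero_right hst,
            smul_neg, neg_neg, inv_smul_smul₀ hs]
        rw [← hq]
        simp
      · exact ⟨1, by simp⟩
  let b := basisOfLinearIndependentOfCardEqFinrank hli (by simp)
  have hb : ⇑b = ![q - p, r - p] := coe_basisOfLinearIndependentOfCardEqFinrank hli _
  have hb0 : b 0 = q - p := by rw [hb]; rfl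
  have hb1 : b 1 = r - p := by rw [hb]; rfl
  refine ⟨LinearMap.toContinuousLinearMap (b.coord 0), LinearMap.toContinuousLinearMap (b.coord 1),
    ?_, ?_, ?_, fun z => ?_⟩
  · rw [← hb0]; simp
  · rw [← hb0]; simp
  · rw [← hb1]; simp
  · have := b.sum_repr z
    rw [Fin.sum_univ_two, hb0, hb1] at this
    exact this

/-- any three non-collinear points lie on the boundary of a unique
range of a nice shape. -/
theorem unique_range_through_three_points
    (S : Set Pt) (hS : NiceShape S)
    (p q r : Pt) (h : ¬ Collinear ℝ ({p, q, r} : Set Pt)) :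
    ∃! T : Set Pt, IsRange S T ∧ p ∈ frontier T ∧ q ∈ frontier T ∧ r ∈ frontier T := by
  obtain ⟨k, g, hku, hgu, hge, hdec⟩ := exists_coord_of_not_collinear h
  have hpq : p ≠ q := by rintro rfl; simp at hku
  have hpr : p ≠ r := by rintro rfl; simp at hge
  have hqr : q ≠ r := by rintro rfl; rw [hgu] at hge; exact zero_ne_one hge
  obtain ⟨a, l, hl, ha, hau, hae⟩ := hS.exists_inscribed_triangle hku hgu hge hdec
  refine ⟨(fun x => l⁻¹ • x + (p - l⁻¹ • a)) '' S,
    ⟨⟨l⁻¹, _, inv_pos.2 hl, rfl⟩, ?_, ?_, ?_⟩, ?_⟩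
  · rw [mem_frontier_homothety_iff (inv_pos.2 hl)]
    convert ha using 1
    simp [smul_sub, smul_smul, hl.ne']
  · rw [mem_frontier_homothety_iff (inv_pos.2 hl)]
    convert hau using 1
    simp [smul_sub, smul_smul, hl.ne']
    abel
  · rw [mem_frontier_homothety_iff (inv_pos.2 hl)]
    convert hae using 1
    simp [smul_sub, smul_smul, hl.ne']
    abel
  · rintro _ ⟨⟨c, v, hc, rfl⟩, hp, hq, hr⟩
    rw [mem_frontier_homothety_iff hc] at hp hq hr
    obtain ⟨hcl, hv⟩ := hS.homothety_unique hdec hpq hqr hpr (inv_pos.2 hc) hl hp hq hr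
      (w₂ := a - l • p) (by convert ha using 1; module) (by convert hau using 1; module)
      (by convert hae using 1; module)
    obtain rfl : c = l⁻¹ := by rw [← hcl, inv_inv]
    have hv' : v = p - l⁻¹ • a := by
      rw [inv_inv, neg_eq_iff_eq_neg, neg_sub] at hv
      rw [← inv_smul_smul₀ hl.ne' v, hv, smul_sub, inv_smul_smul₀ hl.ne']
    rw [hv']
end
end

section
/- For any finite point set X ⊆ ℝ², any positive integer k and any convex compact set S ⊆ ℝ², there exist a nice shape S' ⊆ ℝ² and a finite point set X' ⊆ ℝ² in general position with respect to S' such that |X'| = |X| and the number of k-element subsets of X' captured by some S'-range is at least the number of k-element subsets of X captured by some S-range. -/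
open Set

noncomputable section

open Metric Module

/-- Quadratic upper and lower bounds for the squared distance to a convex set. -/
theorem exists_infDist_sq_bounds {S : Set Pt} (hconv : Convex ℝ S) (hcomp : IsCompact S)
    (hne : S.Nonempty) (p : Pt) :
    ∃ w : Pt, ∀ y : Pt,
      infDist p S ^ 2 + 2 * inner ℝ w (y - p) ≤ infDist y S ^ 2 ∧
      infDist y S ^ 2 ≤ infDist p S ^ 2 + 2 * inner ℝ w (y - p) + ‖y - p‖ ^ 2 := by
  obtain ⟨π, hπ, hdist⟩ := hcomp.exists_infDist_eq_dist hne p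
  have hproj : ∀ s ∈ S, inner ℝ (p - π) (s - π) ≤ 0 := by
    rw [← norm_eq_iInf_iff_real_inner_le_zero hconv hπ, ← dist_eq_norm, ← hdist, infDist_eq_iInf]
    simp only [dist_eq_norm]
  refine ⟨p - π, fun y => ⟨?_, ?_⟩⟩
  · obtain ⟨s, hs, hys⟩ := hcomp.exists_infDist_eq_dist hne y
    rw [hdist, hys, dist_eq_norm, dist_eq_norm]
    have hsq : 0 ≤ ‖(y - s) - (p - π)‖ ^ 2 := sq_nonneg _
    have hsplit : y - s = (y - p) + (p - π) - (s - π) := by abel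
    have hinner : inner ℝ (y - s) (p - π) =
        inner ℝ (p - π) (y - p) + ‖p - π‖ ^ 2 - inner ℝ (p - π) (s - π) := by
      rw [hsplit, inner_sub_left, inner_add_left, real_inner_self_eq_norm_sq,
        real_inner_comm (p - π) (y - p), real_inner_comm (p - π) (s - π)]
    rw [norm_sub_sq_real, hinner] at hsq
    have := hproj s hs
    linarith
  · have hle : infDist y S ≤ ‖y - π‖ := by
      rw [← dist_eq_norm]
      exact infDist_le_dist_of_mem hπ
    have hsq : infDist y S ^ 2 ≤ ‖y - π‖ ^ 2 := pow_le_pow_left₀ infDist_nonneg hle 2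
    have hsplit : y - π = (p - π) + (y - p) := by abel
    rw [hsplit, norm_add_sq_real] at hsq
    rw [hdist, dist_eq_norm]
    exact hsq

/-- A compact sublevel set, at a non-minimal level, of a continuous function that lies between two
quadratic functions touching it at each point is a nice shape. -/
theorem niceShape_sublevel {f : Pt → ℝ} {g : Pt → Pt} {η C a : ℝ} (hη : 0 < η)
    (hf : Continuous f)
    (hlow : ∀ p y, f p + inner ℝ (g p) (y - p) + η * ‖y - p‖ ^ 2 ≤ f y)
    (hup : ∀ p y, f y ≤ f p + inner ℝ (g p) (y - p) + C * ‖y - p‖ ^ 2)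
    (hcomp : IsCompact {x | f x ≤ a}) {z : Pt} (hz : f z < a) :
    NiceShape {x | f x ≤ a} := by
  have hcomb : ∀ x y : Pt, ∀ α β : ℝ, 0 ≤ α → 0 ≤ β → α + β = 1 →
      f (α • x + β • y) + α * (η * ‖x - (α • x + β • y)‖ ^ 2) ≤ α * f x + β * f y := by
    intro x y α β hα hβ hαβ
    set p := α • x + β • y with hp
    have h1 := mul_le_mul_of_nonneg_left (hlow p x) hα
    have h2 := mul_le_mul_of_nonneg_left (hlow p y) hβ
    have h3 : α * inner ℝ (g p) (x - p) + β * inner ℝ (g p) (y - p) = 0 := by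
      rw [← inner_smul_right, ← inner_smul_right, ← inner_add_right]
      have : α • (x - p) + β • (y - p) = 0 := by
        have : α • (x - p) + β • (y - p) = (α • x + β • y) - (α + β) • p := by module
        rw [this, hαβ, one_smul, ← hp, sub_self]
      rw [this, inner_zero_right]
    have h4 : 0 ≤ β * (η * ‖y - p‖ ^ 2) := by positivity
    have h5 : α * f p + β * f p = f p := by rw [← add_mul, hαβ, one_mul]
    nlinarith
  have hfront : ∀ p ∈ frontier {x | f x ≤ a}, f p = a := fun p hp =>
    frontier_le_subset_eq hf continuous_const hp
  refine ⟨⟨z, hz.le⟩, ?_, hcomp, ?_, ?_⟩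
  · intro x hx y hy α β hα hβ hαβ
    have h := hcomb x y α β hα hβ hαβ
    have h1 := mul_le_mul_of_nonneg_left (show f x ≤ a from hx) hα
    have h2 := mul_le_mul_of_nonneg_left (show f y ≤ a from hy) hβ
    have h3 : 0 ≤ α * (η * ‖x - (α • x + β • y)‖ ^ 2) := by positivity
    have h4 : α * a + β * a = a := by rw [← add_mul, hαβ, one_mul]
    show f _ ≤ a
    linarith
  · intro p hp
    have hpa := hfront p hp
    have hgz : inner ℝ (g p) (z - p) < 0 := by
      have h1 := hlow p z
      have h2 : 0 ≤ η * ‖z - p‖ ^ 2 := by positivity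
      linarith
    set φ : Pt →ₗ[ℝ] ℝ := (innerₗ Pt) (g p) with hφ
    have hφ_apply : ∀ x, φ x = inner ℝ (g p) x := fun x => rfl
    have hφ0 : φ ≠ 0 := by
      intro h
      rw [← hφ_apply, h] at hgz
      simp at hgz
    refine ⟨{x | φ x = φ p}, ⟨⟨φ, φ p, hφ0, rfl⟩, ?_⟩, ?_⟩
    · ext x
      simp only [mem_inter_iff, mem_ofPred_eq, mem_singleton_iff]
      constructor
      · rintro ⟨h1, h2⟩
        have h3 := hlow p x
        rw [← hφ_apply, map_sub, h1, sub_self, hpa] at h3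
        have h4 : ‖x - p‖ ^ 2 ≤ 0 := by nlinarith
        have h5 : ‖x - p‖ = 0 := by
          have := le_antisymm h4 (sq_nonneg _)
          simpa using this
        exact sub_eq_zero.mp (norm_eq_zero.mp h5)
      · rintro rfl
        exact ⟨rfl, hpa.le⟩
    · rintro l ⟨⟨h, b, hh0, rfl⟩, hl⟩
      have hpb : h p = b := (hl.symm ▸ mem_singleton p : p ∈ {x | h x = b} ∩ {x | f x ≤ a}).1
      have hker : LinearMap.ker h ≤ LinearMap.ker φ := by
        intro d hd
        rw [LinearMap.mem_ker] at hd ⊢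
        by_contra hφd
        have hd0 : d ≠ 0 := by rintro rfl; simp at hφd
        set D := |C| * ‖d‖ ^ 2 + 1 with hD
        have hDpos : 0 < D := by positivity
        set t := -(φ d) / D with ht
        have ht0 : t ≠ 0 := div_ne_zero (neg_ne_zero.mpr hφd) hDpos.ne'
        have hmem : p + t • d ∈ {x | h x = b} ∩ {x | f x ≤ a} := by
          refine ⟨by simp [hd, hpb], ?_⟩
          have h1 := hup p (p + t • d)
          rw [add_sub_cancel_left, ← hφ_apply, map_smul, norm_smul, mul_pow, hpa, smul_eq_mul,
            Real.norm_eq_abs, sq_abs] at h1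
          have h2 : C * (t ^ 2 * ‖d‖ ^ 2) ≤ D * t ^ 2 := by
            have : C * ‖d‖ ^ 2 ≤ D := by
              have := mul_le_mul_of_nonneg_right (le_abs_self C) (sq_nonneg ‖d‖)
              linarith
            nlinarith [sq_nonneg t]
          have h3 : D * t ^ 2 = - (t * φ d) := by
            rw [ht]; field_simp
          show f _ ≤ a
          linarith
        rw [hl, mem_singleton_iff, add_eq_left, smul_eq_zero] at hmem
        tauto
      have hspan := mem_span_of_iInf_ker_le_ker (ι := Unit) (L := fun _ => h) (K := φ)
        (by simpa using hker)
      obtain ⟨c, hc⟩ := Submodule.mem_span_singleton.mp (by simpa using hspan)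
      have hc0 : c ≠ 0 := by
        rintro rfl
        exact hφ0 (by rw [← hc, zero_smul])
      ext x
      simp [← hc, hc0, hpb]
  · intro x hx y hy hseg
    have hmid : (1 / 2 : ℝ) • x + (1 / 2 : ℝ) • y ∈ segment ℝ x y :=
      ⟨1 / 2, 1 / 2, by norm_num, by norm_num, by norm_num, rfl⟩
    have h1 := hcomb x y (1 / 2) (1 / 2) (by norm_num) (by norm_num) (by norm_num)
    rw [hfront _ (hseg hmid), hfront x hx, hfront y hy] at h1
    have h2 : x - ((1 / 2 : ℝ) • x + (1 / 2 : ℝ) • y) = (1 / 2 : ℝ) • (x - y) := by module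
    rw [h2, norm_smul] at h1
    have h3 : ‖x - y‖ ^ 2 ≤ 0 := by
      norm_num [mul_pow] at h1
      nlinarith
    have h5 : ‖x - y‖ = 0 := by
      have := le_antisymm h3 (sq_nonneg _)
      simpa using this
    exact sub_eq_zero.mp (norm_eq_zero.mp h5)

/-- A non-empty convex compact set can be enlarged to a nice shape that contains it in its interior
and avoids a given finite set of outside points. -/
theorem exists_niceShape_of_nonempty {S : Set Pt} (hconv : Convex ℝ S) (hcomp : IsCompact S)
    (hne : S.Nonempty) {Q : Set Pt} (hQ : Q.Finite) (hQS : Disjoint Q S) :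
    ∃ S' : Set Pt, NiceShape S' ∧ S ⊆ interior S' ∧ Disjoint Q S' ∧ (interior S').Nonempty := by
  obtain ⟨δ, hδ, hδQ⟩ : ∃ δ : ℝ, 0 < δ ∧ ∀ q ∈ Q, δ ≤ infDist q S ^ 2 := by
    have hpos : ∀ q ∈ Q, 0 < infDist q S ^ 2 := fun q hq => by
      have := (hcomp.isClosed.notMem_iff_infDist_pos hne).mp (disjoint_left.mp hQS hq)
      positivity
    rcases Q.eq_empty_or_nonempty with rfl | hQne
    · exact ⟨1, one_pos, by simp⟩
    · obtain ⟨q, hq, hmin⟩ := hQ.exists_minimalFor (fun q => infDist q S ^ 2) Q hQne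
      refine ⟨_, hpos q hq, fun q' hq' => ?_⟩
      rcases le_total (infDist q S ^ 2) (infDist q' S ^ 2) with h | h
      · exact h
      · exact hmin hq' h
  obtain ⟨R, hR, hSR⟩ := hcomp.isBounded.exists_pos_norm_le
  set η := δ / (4 * R ^ 2) with hη_def
  have hη : 0 < η := by positivity
  have hηR : η * R ^ 2 = δ / 4 := by rw [hη_def]; field_simp
  choose w hw using exists_infDist_sq_bounds hconv hcomp hne
  set f : Pt → ℝ := fun x => infDist x S ^ 2 + η * ‖x‖ ^ 2 with hf_def
  have hf : Continuous f := by
    have := continuous_infDist_pt S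
    fun_prop
  have hnorm : ∀ p y : Pt, ‖y‖ ^ 2 = ‖p‖ ^ 2 + 2 * inner ℝ p (y - p) + ‖y - p‖ ^ 2 := by
    intro p y
    rw [← norm_add_sq_real, add_sub_cancel]
  have hinner : ∀ p y : Pt, inner ℝ ((2 : ℝ) • w p + (2 * η) • p) (y - p) =
      2 * inner ℝ (w p) (y - p) + 2 * η * inner ℝ p (y - p) := by
    intro p y
    rw [inner_add_left, real_inner_smul_left, real_inner_smul_left]
  have hSf : ∀ x ∈ S, f x < δ / 2 := by
    intro x hx
    simp only [hf_def, infDist_zero_of_mem hx]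
    have h1 : ‖x‖ ^ 2 ≤ R ^ 2 := pow_le_pow_left₀ (norm_nonneg x) (hSR x hx) 2
    have := mul_le_mul_of_nonneg_left h1 hη.le
    norm_num
    linarith
  have hclosed : IsClosed {x | f x ≤ δ / 2} := isClosed_le hf continuous_const
  have hbounded : Bornology.IsBounded {x | f x ≤ δ / 2} := by
    refine (isBounded_iff_forall_norm_le).mpr ⟨2 * R, fun x hx => ?_⟩
    have hx' : infDist x S ^ 2 + η * ‖x‖ ^ 2 ≤ δ / 2 := hx
    have h1 : η * ‖x‖ ^ 2 ≤ η * (2 * R) ^ 2 := by nlinarith [sq_nonneg (infDist x S)]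
    have h2 : ‖x‖ ^ 2 ≤ (2 * R) ^ 2 := le_of_mul_le_mul_left h1 hη
    exact (sq_le_sq₀ (norm_nonneg x) (by positivity)).mp h2
  have hint : {x | f x < δ / 2} ⊆ interior {x | f x ≤ δ / 2} :=
    interior_maximal (fun x (hx : f x < δ / 2) => show f x ≤ δ / 2 from hx.le)
      (isOpen_lt hf continuous_const)
  obtain ⟨z, hz⟩ := hne
  refine ⟨{x | f x ≤ δ / 2}, ?_, fun x hx => hint (hSf x hx), ?_, ⟨z, hint (hSf z hz)⟩⟩
  · refine niceShape_sublevel (g := fun p => (2 : ℝ) • w p + (2 * η) • p) (C := 1 + η) hη hf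
      (fun p y => ?_) (fun p y => ?_) (isCompact_of_isClosed_isBounded hclosed hbounded)
      (hSf z hz)
    · have := (hw p y).1
      simp only [hf_def, hinner, hnorm p y]
      linarith
    · have := (hw p y).2
      simp only [hf_def, hinner, hnorm p y]
      linarith
  · refine disjoint_left.mpr fun q hq hq' => ?_
    have hq'' : infDist q S ^ 2 + η * ‖q‖ ^ 2 ≤ δ / 2 := hq'
    have := hδQ q hq
    have : 0 ≤ η * ‖q‖ ^ 2 := by positivity
    linarith

/-- A convex compact set can be enlarged to a nice shape that contains it in its interior
and avoids a given finite set of outside points. -/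
theorem exists_niceShape {S : Set Pt} (hconv : Convex ℝ S) (hcomp : IsCompact S)
    {Q : Set Pt} (hQ : Q.Finite) (hQS : Disjoint Q S) :
    ∃ S' : Set Pt, NiceShape S' ∧ S ⊆ interior S' ∧ Disjoint Q S' ∧ (interior S').Nonempty := by
  rcases S.eq_empty_or_nonempty with rfl | hne
  · obtain ⟨z, hz⟩ := hQ.exists_notMem
    obtain ⟨S', hS', -, hQS', hint⟩ := exists_niceShape_of_nonempty (convex_singleton z)
      isCompact_singleton (singleton_nonempty z) hQ (disjoint_singleton_right.mpr hz)
    exact ⟨S', hS', empty_subset _, hQS', hint⟩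
  · exact exists_niceShape_of_nonempty hconv hcomp hne hQ hQS

/-- The frontier of a planar convex body lies on a Lipschitz curve. -/
theorem exists_lipschitz_frontier_subset_range {S : Set Pt} (hconv : Convex ℝ S)
    (hcomp : IsCompact S) (hint : (interior S).Nonempty) :
    ∃ (K : NNReal) (r : ℝ → Pt), LipschitzWith K r ∧ frontier S ⊆ range r := by
  obtain ⟨z, hz⟩ := hint
  set T : Set Pt := (Homeomorph.addRight (-z)) '' S with hT
  have hTconv : Convex ℝ T := by
    simpa [hT, add_comm] using hconv.translate (-z)
  have hTfront : frontier T = (Homeomorph.addRight (-z)) '' frontier S :=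
    ((Homeomorph.addRight (-z)).image_frontier S).symm
  have hT0 : T ∈ nhds (0 : Pt) := by
    rw [← mem_interior_iff_mem_nhds, hT, ← (Homeomorph.addRight (-z)).image_interior]
    exact ⟨z, hz, by simp⟩
  have hTcomp : IsCompact T := hcomp.image (Homeomorph.continuous _)
  obtain ⟨R, hR, hTR⟩ := hTcomp.isBounded.exists_pos_norm_le
  obtain ⟨K, hK⟩ := hTconv.lipschitz_gauge hT0
  set u : ℝ → Pt := fun θ => !₂[Real.cos θ, Real.sin θ] with hu
  have hu_norm : ∀ θ, ‖u θ‖ = 1 := fun θ => by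
    simp [hu, EuclideanSpace.norm_eq]
  have hu_lip : LipschitzWith 2 u := by
    refine LipschitzWith.of_dist_le_mul fun x y => ?_
    have hc : |Real.cos x - Real.cos y| ≤ |x - y| := by
      simpa [Real.dist_eq] using Real.lipschitzWith_cos.dist_le_mul x y
    have hs : |Real.sin x - Real.sin y| ≤ |x - y| := by
      simpa [Real.dist_eq] using Real.lipschitzWith_sin.dist_le_mul x y
    rw [EuclideanSpace.dist_eq]
    refine Real.sqrt_le_iff.mpr ⟨by positivity, ?_⟩
    simp only [hu, Fin.sum_univ_two, Real.dist_eq, NNReal.coe_ofNat]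
    simp only [Matrix.cons_val_zero, Matrix.cons_val_one]
    nlinarith [abs_nonneg (Real.cos x - Real.cos y), abs_nonneg (Real.sin x - Real.sin y)]
  have hgauge : ∀ θ, 1 / R ≤ gauge T (u θ) := fun θ => by
    rw [← hu_norm θ]
    exact le_gauge_of_subset_closedBall (absorbent_nhds_zero hT0) hR.le
      fun x hx => by simpa using hTR x hx
  have hgauge_pos : ∀ θ, 0 < gauge T (u θ) := fun θ =>
    (by positivity : 0 < 1 / R).trans_le (hgauge θ)
  have hinv : ∀ θ, (gauge T (u θ))⁻¹ ≤ R := fun θ =>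
    inv_le_of_inv_le₀ hR (by simpa using hgauge θ)
  refine ⟨⟨2 * R + 2 * K * R ^ 2, by positivity⟩, fun θ => (gauge T (u θ))⁻¹ • u θ + z, ?_, ?_⟩
  · refine LipschitzWith.of_dist_le_mul fun x y => ?_
    set γ := gauge T (u x) with hγ
    set γ' := gauge T (u y) with hγ'
    have hγ0 : 0 < γ := hgauge_pos x
    have hγ'0 : 0 < γ' := hgauge_pos y
    have h1 : ‖u x - u y‖ ≤ 2 * |x - y| := by
      simpa [Real.dist_eq, dist_eq_norm] using hu_lip.dist_le_mul x y
    have h2 : |γ' - γ| ≤ K * ‖u x - u y‖ := by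
      rw [abs_sub_comm]
      simpa [Real.dist_eq, dist_eq_norm] using hK.dist_le_mul (u x) (u y)
    have hsplit : (γ⁻¹ • u x + z) - (γ'⁻¹ • u y + z) =
        γ⁻¹ • (u x - u y) + ((γ' - γ) * (γ⁻¹ * γ'⁻¹)) • u y := by
      have : (γ' - γ) * (γ⁻¹ * γ'⁻¹) = γ⁻¹ - γ'⁻¹ := by field_simp
      rw [this]
      module
    rw [dist_eq_norm, hsplit, Real.dist_eq]
    refine (norm_add_le _ _).trans ?_
    rw [norm_smul, norm_smul, hu_norm, mul_one, Real.norm_eq_abs, Real.norm_eq_abs, abs_mul,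
      abs_of_pos (inv_pos.mpr hγ0), abs_of_pos (mul_pos (inv_pos.mpr hγ0) (inv_pos.mpr hγ'0))]
    have h3 : γ⁻¹ * ‖u x - u y‖ ≤ R * (2 * |x - y|) :=
      mul_le_mul (hinv x) h1 (norm_nonneg _) hR.le
    have h4 : γ⁻¹ * γ'⁻¹ ≤ R * R :=
      mul_le_mul (hinv x) (hinv y) (inv_pos.mpr hγ'0).le hR.le
    have h5 : |γ' - γ| ≤ K * (2 * |x - y|) :=
      h2.trans (mul_le_mul_of_nonneg_left h1 K.coe_nonneg)
    have h6 : |γ' - γ| * (γ⁻¹ * γ'⁻¹) ≤ (K * (2 * |x - y|)) * (R * R) :=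
      mul_le_mul h5 h4 (by positivity) (by positivity)
    refine (add_le_add h3 h6).trans_eq ?_
    show _ = (2 * R + 2 * K * R ^ 2) * |x - y|
    ring
  · intro p hp
    have hpT : p - z ∈ frontier T := by
      rw [hTfront]
      exact ⟨p, hp, by simp [sub_eq_add_neg]⟩
    have hg : gauge T (p - z) = 1 := (gauge_eq_one_iff_mem_frontier hTconv hT0).mpr hpT
    set ζ : ℂ := ⟨(p - z) 0, (p - z) 1⟩ with hζ
    have hpolar : p - z = ‖ζ‖ • u ζ.arg := by
      ext i
      fin_cases i
      · simp [hu, hζ]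
      · simp [hu, hζ]
    refine ⟨ζ.arg, ?_⟩
    rw [hpolar, gauge_smul_of_nonneg (norm_nonneg _), smul_eq_mul] at hg
    have hinv_eq : (gauge T (u ζ.arg))⁻¹ = ‖ζ‖ := inv_eq_of_mul_eq_one_left hg
    show (gauge T (u ζ.arg))⁻¹ • u ζ.arg + z = p
    rw [hinv_eq, ← hpolar, sub_add_cancel]

/-- Configurations in which one point is a smooth function of one real parameter and of the other
points have positive codimension. -/
theorem dimH_point_dependent_lt {n : ℕ} (k : Fin n)
    {φ : ℝ × ({m : Fin n // m ≠ k} → Pt) → Pt} (hφ : ContDiff ℝ 1 φ) :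
    dimH {x : Fin n → Pt | ∃ t : ℝ, x k = φ (t, fun m => x m)} < finrank ℝ (Fin n → Pt) := by
  set F : ℝ × ({m : Fin n // m ≠ k} → Pt) → (Fin n → Pt) :=
    fun q m => if h : m = k then φ q else q.2 ⟨m, h⟩ with hF
  have hFsmooth : ContDiff ℝ 1 F := by
    refine contDiff_pi.mpr fun m => ?_
    by_cases h : m = k
    · simpa [hF, h] using hφ
    · simp only [hF, h, dite_false]
      fun_prop
  have hsub : {x : Fin n → Pt | ∃ t : ℝ, x k = φ (t, fun m => x m)} ⊆ range F := by
    rintro x ⟨t, ht⟩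
    refine ⟨(t, fun m => x m), funext fun m => ?_⟩
    by_cases h : m = k
    · subst h
      simp [hF, ht]
    · simp [hF, h]
  refine ((dimH_mono hsub).trans hFsmooth.dimH_range_le).trans_lt ?_
  have hn : 0 < n := k.pos
  have hcard : Fintype.card {m : Fin n // m ≠ k} = n - 1 := by
    simp [Fintype.card_subtype_compl]
  rw [Module.finrank_prod, Module.finrank_pi_fintype, Module.finrank_pi_fintype]
  simp only [finrank_euclideanSpace, Fintype.card_fin, Finset.sum_const, Finset.card_univ, hcard,
    Module.finrank_self, smul_eq_mul]
  exact_mod_cast (by omega : 1 + (n - 1) * 2 < n * 2)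

/-- Configurations with four points on a common homothetic copy of a Lipschitz curve have
positive codimension. -/
theorem dimH_four_on_curve_lt {n : ℕ} {I : Finset (Fin n)} (hI : I.card = 4) {K : NNReal}
    {r : ℝ → Pt} (hr : LipschitzWith K r) :
    dimH {x : Fin n → Pt | ∃ (c : ℝ) (v : Pt), ∀ m ∈ I, ∃ t, x m = c • r t + v} <
      finrank ℝ (Fin n → Pt) := by
  set L : (I → ℝ) × ({m : Fin n // m ∉ I} → Pt) × ℝ × Pt →
      (I → Pt) × ({m : Fin n // m ∉ I} → Pt) × ℝ × Pt :=
    Prod.map (fun t m => r (t m)) id with hL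
  set G : (I → Pt) × ({m : Fin n // m ∉ I} → Pt) × ℝ × Pt → (Fin n → Pt) :=
    fun q m => if h : m ∈ I then q.2.2.1 • q.1 ⟨m, h⟩ + q.2.2.2 else q.2.1 ⟨m, h⟩ with hG
  have hLlip : LipschitzWith (max K 1) L := by
    have h1 : LipschitzWith K (fun (t : I → ℝ) m => r (t m)) := by
      refine LipschitzWith.of_dist_le_mul fun s t => ?_
      refine (dist_pi_le_iff (by positivity)).mpr fun m => ?_
      exact (hr.dist_le_mul _ _).trans
        (mul_le_mul_of_nonneg_left (dist_le_pi_dist s t m) K.coe_nonneg)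
    simpa [hL, Prod.map_def, Function.comp_def] using
      (h1.comp LipschitzWith.prod_fst).prodMk LipschitzWith.prod_snd
  have hGsmooth : ContDiff ℝ 1 G := by
    refine contDiff_pi.mpr fun m => ?_
    by_cases h : m ∈ I
    · simp only [hG, h, dite_true]
      fun_prop
    · simp only [hG, h, dite_false]
      fun_prop
  have hsub : {x : Fin n → Pt | ∃ (c : ℝ) (v : Pt), ∀ m ∈ I, ∃ t, x m = c • r t + v} ⊆
      G '' range L := by
    rintro x ⟨c, v, hx⟩
    choose t ht using hx
    refine ⟨_, ⟨(fun m => t m m.2, fun m => x m, c, v), rfl⟩, funext fun m => ?_⟩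
    by_cases h : m ∈ I
    · simp [hG, hL, h, ← ht]
    · simp [hG, hL, h]
  have hdim : dimH (G '' range L) ≤
      finrank ℝ ((I → ℝ) × ({m : Fin n // m ∉ I} → Pt) × ℝ × Pt) := by
    rw [← Real.dimH_univ_eq_finrank]
    exact (hGsmooth.contDiffOn.dimH_image_le convex_univ (subset_univ _)).trans hLlip.dimH_range_le
  refine ((dimH_mono hsub).trans hdim).trans_lt ?_
  have hn : 4 ≤ n := by
    rw [← hI]
    exact (Finset.card_le_univ I).trans_eq (Fintype.card_fin n)
  have hcard : Fintype.card {m : Fin n // m ∉ I} = n - 4 := by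
    simp [Fintype.card_subtype_compl, hI]
  simp only [Module.finrank_prod, Module.finrank_pi_fintype]
  simp only [finrank_euclideanSpace, Fintype.card_fin, Finset.sum_const, Finset.card_univ, hcard,
    Module.finrank_self, smul_eq_mul, Fintype.card_coe, hI]
  exact_mod_cast (by omega : 4 * 1 + ((n - 4) * 2 + (1 + 2)) < n * 2)

/-- The homothety `x ↦ c • x + v` as a homeomorphism of the plane. -/
def homothetyHomeomorph {c : ℝ} (hc : c ≠ 0) (v : Pt) : Pt ≃ₜ Pt :=
  (Homeomorph.smulOfNeZero c hc).trans (Homeomorph.addRight v)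

theorem coe_homothetyHomeomorph {c : ℝ} (hc : c ≠ 0) (v : Pt) :
    ⇑(homothetyHomeomorph hc v) = fun x => c • x + v := rfl

/-- Being collinear with two distinct points means lying on the line spanned by them. -/
theorem exists_eq_add_smul_sub_of_collinear {p q s : Pt} (hpq : p ≠ q)
    (h : Collinear ℝ ({p, q, s} : Set Pt)) : ∃ t : ℝ, s = p + t • (q - p) := by
  obtain ⟨d, hd⟩ := (collinear_iff_of_mem (p₀ := p) (by simp)).mp h
  obtain ⟨a, ha⟩ := hd q (by simp)
  obtain ⟨b, hb⟩ := hd s (by simp)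
  rw [vadd_eq_add] at ha hb
  have ha0 : a ≠ 0 := by
    rintro rfl
    exact hpq (by simp [ha])
  refine ⟨b / a, ?_⟩
  rw [ha, hb, add_sub_cancel_right, smul_smul, div_mul_cancel₀ b ha0, add_comm]

/-- Injective configurations in general position are dense. -/
theorem dense_genPos {S : Set Pt} (hconv : Convex ℝ S) (hcomp : IsCompact S)
    (hint : (interior S).Nonempty) (n : ℕ) :
    Dense {x : Fin n → Pt | Function.Injective x ∧ GenPos S (Finset.univ.image x)} := by
  rcases n.eq_zero_or_pos with rfl | hn
  · refine dense_univ.mono fun x _ => ?_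
    exact ⟨Function.injective_of_subsingleton x, by simp, by simp, by simp [NoFourOnBoundary]⟩
  obtain ⟨K, r, hr, hfront⟩ := exists_lipschitz_frontier_subset_range hconv hcomp hint
  set A : {ij : Fin n × Fin n // ij.1 ≠ ij.2} → Set (Fin n → Pt) :=
    fun ij => {x | x ij.1.1 0 = x ij.1.2 0}
  set B : {ijk : Fin n × Fin n × Fin n // ijk.1 ≠ ijk.2.2 ∧ ijk.2.1 ≠ ijk.2.2} →
      Set (Fin n → Pt) :=
    fun ijk => {x | ∃ t : ℝ,
      x ijk.1.2.2 = x ijk.1.1 + t • (x ijk.1.2.1 - x ijk.1.1)}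
  set D : {I : Finset (Fin n) // I.card = 4} → Set (Fin n → Pt) :=
    fun I => {x | ∃ (c : ℝ) (v : Pt), ∀ m ∈ I.1, ∃ t, x m = c • r t + v}
  have hAdim : ∀ ij, dimH (A ij) < finrank ℝ (Fin n → Pt) := by
    rintro ⟨⟨i, j⟩, hij⟩
    have hφ : ContDiff ℝ 1 (fun q : ℝ × ({m : Fin n // m ≠ j} → Pt) =>
        (!₂[q.2 ⟨i, hij⟩ 0, q.1] : Pt)) := by
      rw [contDiff_euclidean]
      intro l
      fin_cases l
      · simp only [Fin.zero_eta, Matrix.cons_val_zero]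
        fun_prop
      · exact contDiff_fst
    refine (dimH_mono ?_).trans_lt (dimH_point_dependent_lt j hφ)
    intro x hx
    refine ⟨x j 1, ?_⟩
    have hx' : x i 0 = x j 0 := hx
    ext l
    fin_cases l
    · simp [hx']
    · simp
  have hBdim : ∀ ijk, dimH (B ijk) < finrank ℝ (Fin n → Pt) := by
    rintro ⟨⟨i, j, k⟩, hik, hjk⟩
    exact dimH_point_dependent_lt k
      (φ := fun q => q.2 ⟨i, hik⟩ + q.1 • (q.2 ⟨j, hjk⟩ - q.2 ⟨i, hik⟩)) (by fun_prop)
  have hDdim : ∀ I, dimH (D I) < finrank ℝ (Fin n → Pt) := fun I => dimH_four_on_curve_lt I.2 hr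
  have hbad : dimH ((⋃ ij, A ij) ∪ (⋃ ijk, B ijk) ∪ ⋃ I, D I) < finrank ℝ (Fin n → Pt) := by
    have hpos : (⊥ : ENNReal) < finrank ℝ (Fin n → Pt) := by
      have : Nonempty (Fin n) := ⟨⟨0, hn⟩⟩
      exact Nat.cast_pos.mpr (finrank_pos (R := ℝ) (M := Fin n → Pt))
    simp only [dimH_union, dimH_iUnion, ← Finset.sup_univ_eq_iSup, max_lt_iff,
      Finset.sup_lt_iff hpos]
    exact ⟨⟨fun ij _ => hAdim ij, fun ijk _ => hBdim ijk⟩, fun I _ => hDdim I⟩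
  refine (dense_compl_of_dimH_lt_finrank hbad).mono fun x hx => ?_
  simp only [mem_compl_iff, mem_union, mem_iUnion, not_or, not_exists] at hx
  obtain ⟨⟨hxA, hxB⟩, hxD⟩ := hx
  have hcoord : ∀ i j, i ≠ j → x i 0 ≠ x j 0 := fun i j hij => hxA ⟨(i, j), hij⟩
  have hinj : Function.Injective x := fun i j hij => by
    by_contra hne
    exact hcoord i j hne (by rw [hij])
  refine ⟨hinj, ?_, ?_, ?_⟩
  · simp only [Finset.mem_image, Finset.mem_univ, true_and, forall_exists_index,
      forall_apply_eq_imp_iff]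
    exact fun i j hij => hcoord i j fun h => hij (by rw [h])
  · simp only [Finset.mem_image, Finset.mem_univ, true_and, forall_exists_index,
      forall_apply_eq_imp_iff]
    intro i j k hij hik hjk hcol
    exact hxB ⟨(i, j, k), fun h => hik (congrArg x h), fun h => hjk (congrArg x h)⟩
      (exists_eq_add_smul_sub_of_collinear hij hcol)
  · rintro T ⟨c, v, hc, rfl⟩ p₁ p₂ p₃ p₄ ⟨hp₁, hf₁⟩ ⟨hp₂, hf₂⟩ ⟨hp₃, hf₃⟩ ⟨hp₄, hf₄⟩
      h₁₂ h₁₃ h₁₄ h₂₃ h₂₄ h₃₄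
    simp only [Finset.coe_image, Finset.coe_univ, image_univ, mem_range] at hp₁ hp₂ hp₃ hp₄
    obtain ⟨i₁, rfl⟩ := hp₁
    obtain ⟨i₂, rfl⟩ := hp₂
    obtain ⟨i₃, rfl⟩ := hp₃
    obtain ⟨i₄, rfl⟩ := hp₄
    have hcurve : ∀ p, p ∈ frontier ((fun y : Pt => c • y + v) '' S) →
        ∃ t, p = c • r t + v := by
      intro p hp
      rw [← coe_homothetyHomeomorph hc.ne', ← Homeomorph.image_frontier] at hp
      obtain ⟨y, hy, rfl⟩ := hp
      obtain ⟨t, rfl⟩ := hfront hy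
      exact ⟨t, rfl⟩
    refine hxD ⟨{i₁, i₂, i₃, i₄}, ?_⟩ ⟨c, v, ?_⟩
    · rw [hinj.ne_iff] at h₁₂ h₁₃ h₁₄ h₂₃ h₂₄ h₃₄
      simp [h₁₂, h₁₃, h₁₄, h₂₃, h₂₄, h₃₄]
    · intro m hm
      simp only [Finset.mem_insert, Finset.mem_singleton] at hm
      rcases hm with rfl | rfl | rfl | rfl
      exacts [hcurve _ hf₁, hcurve _ hf₂, hcurve _ hf₃, hcurve _ hf₄]

/-- the general case reduces to a nice shape and a point set in
general position, without decreasing the number of captured `k`-sets. -/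
theorem reduction_to_nice_shape_and_general_position
    (X : Finset Pt) (k : ℕ) (hk : 1 ≤ k)
    (S : Set Pt) (hconv : Convex ℝ S) (hcomp : IsCompact S) :
    ∃ (S' : Set Pt) (X' : Finset Pt), NiceShape S' ∧ GenPos S' X' ∧
      X'.card = X.card ∧
      (capturedSets S X k).ncard ≤ (capturedSets S' X' k).ncard := by
  have hfin : ∀ (S₀ : Set Pt) (X₀ : Finset Pt), (capturedSets S₀ X₀ k).Finite := fun S₀ X₀ =>
    X₀.finite_toSet.finite_subsets.subset fun Y hY => hY.1
  have hhom : ∀ Y : capturedSets S X k, ∃ (c : ℝ) (hc : c ≠ 0) (v : Pt), 0 < c ∧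
      ↑X ∩ homothetyHomeomorph hc v '' S = Y.1 := by
    rintro ⟨Y, -, -, T, ⟨c, v, hc, rfl⟩, hY⟩
    exact ⟨c, hc.ne', v, hc, hY⟩
  choose c hc v hcpos hcap using hhom
  set H : capturedSets S X k → Pt ≃ₜ Pt := fun Y => homothetyHomeomorph (hc Y) (v Y) with hH
  have : Finite (capturedSets S X k) := hfin S X
  have hQfin : (⋃ Y : capturedSets S X k, (H Y).symm '' (↑X \ Y.1)).Finite :=
    finite_iUnion fun Y => (X.finite_toSet.subset sdiff_subset).image _
  have hQdisj : Disjoint (⋃ Y : capturedSets S X k, (H Y).symm '' (↑X \ Y.1)) S := by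
    rw [disjoint_iUnion_left]
    refine fun Y => disjoint_left.mpr ?_
    rintro _ ⟨q, ⟨hqX, hqY⟩, rfl⟩ hqS
    refine hqY ?_
    rw [← hcap Y]
    exact ⟨hqX, _, hqS, (H Y).apply_symm_apply q⟩
  obtain ⟨S', hnice, hSS', hQS', hint⟩ := exists_niceShape hconv hcomp hQfin hQdisj
  have hclosed : ∀ Y, IsClosed (H Y '' S') := fun Y =>
    (H Y).isClosed_image.mpr hnice.2.2.1.isClosed
  set e : Fin X.card → Pt := fun i => X.equivFin.symm i with he
  have he_inj : Function.Injective e := Subtype.val_injective.comp X.equivFin.symm.injective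
  have he_range : range e = ↑X := by
    rw [he, range_comp' Subtype.val]
    simp
  set U : Set (Fin X.card → Pt) :=
    ⋂ (Y : capturedSets S X k) (i : Fin X.card),
      {x | (e i ∈ Y.1 → x i ∈ interior (H Y '' S')) ∧ (e i ∉ Y.1 → x i ∈ (H Y '' S')ᶜ)} with hU
  have hUopen : IsOpen U := by
    refine isOpen_iInter_of_finite fun Y => isOpen_iInter_of_finite fun i => ?_
    by_cases h : e i ∈ Y.1
    · simp only [h, not_true_eq_false, true_implies, false_implies, and_true]
      exact isOpen_interior.preimage (continuous_apply i)
    · simp only [h, not_false_eq_true, true_implies, false_implies, true_and]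
      exact (hclosed Y).isOpen_compl.preimage (continuous_apply i)
  have heX : ∀ i, e i ∈ (X : Set Pt) := fun i => he_range ▸ mem_range_self i
  have heU : e ∈ U := by
    simp only [hU, mem_iInter]
    refine fun Y i => ⟨fun h => ?_, fun h => ?_⟩
    · rw [← hcap Y] at h
      rw [← Homeomorph.image_interior]
      exact image_mono hSS' h.2
    · rintro ⟨s, hs, hsi⟩
      refine disjoint_left.mp hQS' (mem_iUnion.mpr ⟨Y, e i, ⟨heX i, h⟩, ?_⟩) hs
      rw [← hsi, Homeomorph.symm_apply_apply]
  obtain ⟨x, hxU, hx_inj, hgen⟩ :=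
    (dense_genPos hnice.2.1 hnice.2.2.1 hint X.card).inter_open_nonempty U hUopen ⟨e, heU⟩
  simp only [hU, mem_iInter] at hxU
  refine ⟨S', Finset.univ.image x, hnice, hgen, ?_, ?_⟩
  · rw [Finset.card_image_of_injective _ hx_inj, Finset.card_univ, Fintype.card_fin]
  · refine ncard_le_ncard_of_injOn (fun Y => x '' (e ⁻¹' Y)) ?_ ?_ (hfin _ _)
    · intro Y hY
      refine ⟨by simp, ?_, H ⟨Y, hY⟩ '' S', ⟨_, _, hcpos ⟨Y, hY⟩, rfl⟩, ?_⟩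
      · rw [ncard_image_of_injective _ hx_inj,
          ncard_preimage_of_injective_subset_range he_inj (he_range ▸ hY.1), hY.2.1]
      · ext p
        simp only [Finset.coe_image, Finset.coe_univ, image_univ, mem_inter_iff, mem_range]
        constructor
        · rintro ⟨⟨i, rfl⟩, hi⟩
          refine ⟨i, ?_, rfl⟩
          by_contra h
          exact (hxU ⟨Y, hY⟩ i).2 h hi
        · rintro ⟨i, hi, rfl⟩
          exact ⟨⟨i, rfl⟩, interior_subset ((hxU ⟨Y, hY⟩ i).1 hi)⟩
    · intro Y hY Y' hY' h
      have h' := hx_inj.image_injective h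
      rw [← image_preimage_eq_of_subset (he_range ▸ hY.1 : Y ⊆ range e), h',
        image_preimage_eq_of_subset (he_range ▸ hY'.1 : Y' ⊆ range e)]
end
end

section
/- Let S ⊆ ℝ² be a nice shape, X ⊆ ℝ² a finite point set, and p, q ∈ ℝ² distinct points such that no four points of X ∪ {p,q} lie on the boundary of a common S-range. Let L be one of the open halfplanes bounded by the line through p and q, and let S₁ ∈ 𝒮_pq. Then the set {S₂ ∈ 𝒮_pq : S₁ ≺ S₂ and (∂S₂ ∖ ∂S₁) ∩ X ≠ ∅} has a ≺-minimal element if and only if the interior of the symmetric difference S₁ △ L = (S₁ ∖ L) ∪ (L ∖ S₁) contains a point of X. -/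
open Set

noncomputable section

section NiceShapes

variable {S : Set Pt}

lemma NiceShape.isClosed (hS : NiceShape S) : IsClosed S := hS.2.2.1.isClosed

lemma NiceShape.strictConvex (hS : NiceShape S) : StrictConvex ℝ S := by
  have hcl := hS.isClosed
  obtain ⟨-, hconv, -, -, hseg⟩ := hS
  refine hconv.strictConvex fun x hx y hy hxy => ?_
  rw [← hcl.frontier_eq] at hx hy
  by_contra hne
  refine hxy (hseg x hx y hy ?_)
  rwa [Set.not_nonempty_iff_eq_empty, Set.sdiff_eq_empty] at hne

lemma NiceShape.interior_nonempty_s12 (hS : NiceShape S) : (interior S).Nonempty := by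
  have hcl := hS.isClosed
  obtain ⟨⟨s, hs⟩, hconv, -, htouch, hseg⟩ := hS
  by_contra hne
  rw [Set.not_nonempty_iff_eq_empty] at hne
  have hfr : frontier S = S := by rw [hcl.frontier_eq, hne, Set.sdiff_empty]
  rw [hfr] at htouch hseg
  have hsingle : S = {s} := by
    ext y
    refine ⟨fun hy => hseg y hy s hs (hconv.segment_subset hy hs), fun hy => ?_⟩
    rwa [Set.mem_singleton_iff.1 hy]
  have hline : ∀ i : Fin 2, IsLine {x : Pt | x i = s i} ∧ {x : Pt | x i = s i} ∩ S = {s} := by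
    intro i
    refine ⟨⟨(EuclideanSpace.proj i : Pt →L[ℝ] ℝ).toLinearMap, s i, ?_, rfl⟩, ?_⟩
    · intro h0
      have := LinearMap.congr_fun h0 (EuclideanSpace.single i (1 : ℝ))
      simp at this
    · rw [hsingle]
      ext y
      simp only [Set.mem_inter_iff, Set.mem_ofPred_eq, Set.mem_singleton_iff]
      exact ⟨fun h => h.2, fun h => ⟨by rw [h], h⟩⟩
  have heq := (htouch s hs).unique (hline 0) (hline 1)
  have hmem : s + EuclideanSpace.single 1 (1 : ℝ) ∈ {x : Pt | x 0 = s 0} := by simp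
  rw [heq] at hmem
  simp at hmem

/-- A nonzero linear functional has no minimum at an interior point. -/
lemma exists_mem_lt_of_mem_interior {T : Set Pt} {f : Pt →ₗ[ℝ] ℝ} (hf : f ≠ 0) {m : Pt}
    (hm : m ∈ interior T) : ∃ y ∈ T, f y < f m := by
  obtain ⟨v, hv⟩ : ∃ v, f v ≠ 0 := by
    by_contra! h
    exact hf (LinearMap.ext h)
  have hcont : Filter.Tendsto (fun t : ℝ => m - (t * f v) • v) (nhdsWithin 0 (Set.Ioi 0))
      (nhds m) := by
    have : Continuous fun t : ℝ => m - (t * f v) • v := by fun_prop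
    have h := (this.tendsto 0).mono_left (nhdsWithin_le_nhds (s := Set.Ioi 0))
    simpa using h
  obtain ⟨t, ht, ht0⟩ :=
    ((hcont.eventually (mem_interior_iff_mem_nhds.1 hm)).and self_mem_nhdsWithin).exists
  refine ⟨_, ht, ?_⟩
  have : 0 < t * (f v * f v) := mul_pos ht0 (mul_self_pos.2 hv)
  simp only [map_sub, map_smul, smul_eq_mul]
  linarith

/-- A supporting line of a strictly convex set touches it in a single point. -/
lemma StrictConvex.level_inter_eq_singleton {T : Set Pt} (hT : StrictConvex ℝ T)
    {f : Pt →ₗ[ℝ] ℝ} (hf : f ≠ 0) {b : Pt} (hb : b ∈ T) (hmin : ∀ y ∈ T, f b ≤ f y) :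
    {x | f x = f b} ∩ T = {b} := by
  ext y
  simp only [Set.mem_inter_iff, Set.mem_ofPred_eq, Set.mem_singleton_iff]
  refine ⟨fun ⟨hy, hyT⟩ => ?_, fun h => by rw [h]; exact ⟨rfl, hb⟩⟩
  by_contra hne
  have hmid := hT hyT hb hne (a := 1 / 2) (b := 1 / 2) (by norm_num) (by norm_num) (by norm_num)
  obtain ⟨z, hzT, hz⟩ := exists_mem_lt_of_mem_interior hf hmid
  have := hmin z hzT
  simp only [map_add, map_smul, smul_eq_mul, hy] at hz
  linarith

/-- Every direction pointing strictly to the inner side of the tangent line at a boundary point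
of a nice shape enters the shape. -/
lemma NiceShape.exists_add_smul_mem (hS : NiceShape S) {f : Pt →ₗ[ℝ] ℝ} (hf : f ≠ 0) {b w : Pt}
    (hb : b ∈ S) (hmin : ∀ y ∈ S, f b ≤ f y) (hw : 0 < f w) : ∃ ε > (0 : ℝ), b + ε • w ∈ S := by
  by_contra! hno
  have hsc := hS.strictConvex
  have hcl := hS.isClosed
  obtain ⟨y₀, hy₀⟩ := hS.interior_nonempty_s12
  have hbint : b ∉ interior S := fun h => by
    obtain ⟨y, hy, hlt⟩ := exists_mem_lt_of_mem_interior hf h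
    exact (hmin y hy).not_gt hlt
  have hconvR : Convex ℝ ((fun ε : ℝ => b + ε • w) '' Set.Ioi 0) := by
    have := (convex_Ioi (0 : ℝ)).is_linear_image (f := fun ε : ℝ => ε • w)
      ⟨fun _ _ => add_smul _ _ _, fun c x => by rw [smul_eq_mul, mul_smul]⟩
    have h2 := this.translate b
    rwa [Set.image_image] at h2
  have hdisj : Disjoint (interior S) ((fun ε : ℝ => b + ε • w) '' Set.Ioi 0) := by
    rw [Set.disjoint_right]
    rintro _ ⟨ε, hε, rfl⟩ hmem
    exact hno ε hε (interior_subset hmem)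
  obtain ⟨g, u, hg₁, hg₂⟩ :=
    geometric_hahn_banach_open hsc.convex.interior isOpen_interior hconvR hdisj
  have hgS : ∀ y ∈ S, g y ≤ u := by
    have hsub : closure (interior S) ⊆ {y | g y ≤ u} :=
      closure_minimal (fun y hy => (hg₁ y hy).le) (isClosed_le g.continuous continuous_const)
    rw [hsc.convex.closure_interior_eq_closure_of_nonempty_interior ⟨y₀, hy₀⟩,
      hcl.closure_eq] at hsub
    exact hsub
  have hray : ∀ ε : ℝ, 0 < ε → u ≤ g b + ε * g w := fun ε hε => by
    have := hg₂ _ ⟨ε, hε, rfl⟩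
    simpa using this
  have hgb : g b = u := by
    refine le_antisymm (hgS b hb) ?_
    have hcont : Filter.Tendsto (fun ε : ℝ => g b + ε * g w) (nhdsWithin 0 (Set.Ioi 0))
        (nhds (g b)) := by
      have : Continuous fun ε : ℝ => g b + ε * g w := by fun_prop
      have h := (this.tendsto 0).mono_left (nhdsWithin_le_nhds (s := Set.Ioi 0))
      simpa using h
    refine ge_of_tendsto hcont ?_
    filter_upwards [self_mem_nhdsWithin] with ε hε using hray ε hε
  have hgw : 0 ≤ g w := by
    have := hray 1 one_pos
    linarith
  have hg0 : (-g).toLinearMap ≠ 0 := fun h => by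
    have h1 := LinearMap.congr_fun h y₀
    have h2 := LinearMap.congr_fun h b
    have h3 := hg₁ y₀ hy₀
    simp at h1 h2
    linarith
  have hbfr : b ∈ frontier S := by
    rw [hcl.frontier_eq]
    exact ⟨hb, hbint⟩
  have hlines := (hS.2.2.2.1 b hbfr).unique
    ⟨⟨f, f b, hf, rfl⟩, hsc.level_inter_eq_singleton hf hb hmin⟩
    ⟨⟨(-g).toLinearMap, (-g).toLinearMap b, hg0, rfl⟩,
      hsc.level_inter_eq_singleton hg0 hb (fun y hy => by
        have := hgS y hy
        simp
        linarith)⟩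
  have hfv : 0 < f (y₀ - b) := by
    obtain ⟨y, hy, hlt⟩ := exists_mem_lt_of_mem_interior hf hy₀
    have := hmin y hy
    rw [map_sub]
    linarith
  have hgv : g (y₀ - b) < 0 := by
    have := hg₁ y₀ hy₀
    rw [map_sub]
    linarith
  have hmem : b + (w - (f w / f (y₀ - b)) • (y₀ - b)) ∈ {x | f x = f b} := by
    simp only [Set.mem_ofPred_eq, map_add, map_sub f w, map_smul, smul_eq_mul]
    rw [div_mul_cancel₀ _ hfv.ne']
    ring
  rw [hlines] at hmem
  have hkey : g w = f w / f (y₀ - b) * g (y₀ - b) := by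
    simp only [Set.mem_ofPred_eq, ContinuousLinearMap.coe_coe, neg_apply,
      map_add, map_sub g w, map_smul, smul_eq_mul] at hmem
    linarith
  have := mul_neg_of_pos_of_neg (div_pos hw hfv) hgv
  linarith

end NiceShapes

section InscribedTriangle

variable {A : Set (ℝ × ℝ)}

lemma exists_pos_forall_add_mem_of_mem_interior {m : ℝ × ℝ} (hm : m ∈ interior A) :
    ∃ δ > 0, ∀ u v : ℝ, |u| ≤ δ → |v| ≤ δ → (m.1 + u, m.2 + v) ∈ A := by
  obtain ⟨δ, hδ, hball⟩ := Metric.isOpen_iff.1 isOpen_interior m hm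
  refine ⟨δ / 2, by positivity, fun u v hu hv => interior_subset (hball ?_)⟩
  rw [Metric.mem_ball, Prod.dist_eq, max_lt_iff]
  constructor <;> simp only [Real.dist_eq, add_sub_cancel_left] <;> linarith

lemma Convex.mem_of_mem_of_mem_row (hA : Convex ℝ A) {u v y h : ℝ} (hu : (u, h) ∈ A)
    (hv : (v, h) ∈ A) (huy : u ≤ y) (hyv : y ≤ v) : (y, h) ∈ A := by
  have hrow : Convex ℝ {y : ℝ | (y, h) ∈ A} := by
    intro y₁ h₁ y₂ h₂ a b ha hb hab
    have := hA h₁ h₂ ha hb hab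
    simp only [Prod.smul_mk, Prod.mk_add_mk, ← add_smul, hab, one_smul] at this
    exact this
  exact hrow.ordConnected.out hu hv ⟨huy, hyv⟩

lemma isCompact_row (hA : IsCompact A) (h : ℝ) : IsCompact {y : ℝ | (y, h) ∈ A} := by
  have : {y : ℝ | (y, h) ∈ A} = Prod.fst '' (A ∩ {z | z.2 = h}) := by
    ext y
    constructor
    · exact fun hy => ⟨(y, h), ⟨hy, rfl⟩, rfl⟩
    · rintro ⟨⟨y', h'⟩, ⟨hz, rfl⟩, rfl⟩
      exact hz
  rw [this]
  exact (hA.inter_right (isClosed_eq continuous_snd continuous_const)).image continuous_fst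

lemma Convex.add_smul_mem_of_le {E : Type*} [AddCommGroup E] [Module ℝ E] {T : Set E}
    (hT : Convex ℝ T) {b w : E} {s ε : ℝ} (hb : b ∈ T) (hw : b + ε • w ∈ T) (hs : 0 ≤ s)
    (hsε : s ≤ ε) (hε : 0 < ε) : b + s • w ∈ T := by
  have := hT.add_smul_mem hb hw (t := s / ε) ⟨by positivity, (div_le_one hε).2 hsε⟩
  rwa [smul_smul, div_mul_cancel₀ _ hε.ne'] at this

/-- If a compact strictly convex planar set has horizontal tangents as its only supporting lines
at its lowest and at its highest points, then it has an inscribed isosceles right triangle with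
legs pointing right and up. -/
lemma exists_inscribed_right_triangle (hsc : StrictConvex ℝ A) (hcpt : IsCompact A)
    (hne : (interior A).Nonempty)
    (hbot : ∀ b ∈ A, (∀ y ∈ A, b.2 ≤ y.2) → ∀ w : ℝ × ℝ, 0 < w.2 → ∃ ε > (0 : ℝ), b + ε • w ∈ A)
    (htop : ∀ b ∈ A, (∀ y ∈ A, y.2 ≤ b.2) → ∀ w : ℝ × ℝ, w.2 < 0 → ∃ ε > (0 : ℝ), b + ε • w ∈ A) :
    ∃ l h c : ℝ, 0 < c ∧ (l, h) ∈ frontier A ∧ (l + c, h) ∈ frontier A ∧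
      (l, h + c) ∈ frontier A := by
  have hconv := hsc.convex
  have hcl := hcpt.isClosed
  obtain ⟨m, hm⟩ := hne
  obtain ⟨b, hb, hbmin⟩ := hcpt.exists_isMinOn ⟨m, interior_subset hm⟩ continuous_snd.continuousOn
  obtain ⟨t, ht, htmax⟩ := hcpt.exists_isMaxOn ⟨m, interior_subset hm⟩ continuous_snd.continuousOn
  replace hbmin : ∀ y ∈ A, b.2 ≤ y.2 := fun y hy => hbmin hy
  replace htmax : ∀ y ∈ A, y.2 ≤ t.2 := fun y hy => htmax hy
  have hbt : b.2 < t.2 := by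
    obtain ⟨δ, hδ, hmem⟩ := exists_pos_forall_add_mem_of_mem_interior hm
    have h1 := hbmin _ (hmem 0 (-δ) (by simpa using hδ.le) (by simp [abs_of_pos hδ]))
    have h2 := htmax _ (hmem 0 δ (by simpa using hδ.le) (by simp [abs_of_pos hδ]))
    simp only at h1 h2
    linarith
  have hbt_ne : b ≠ t := fun h => by rw [h] at hbt; exact lt_irrefl _ hbt
  have hbuniq : ∀ y ∈ A, y.2 = b.2 → y = b := by
    intro y hy hyb
    by_contra hneq
    have hmid := hsc hy hb hneq (a := 1 / 2) (b := 1 / 2) (by norm_num) (by norm_num)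
      (by norm_num)
    obtain ⟨δ, hδ, hmem⟩ := exists_pos_forall_add_mem_of_mem_interior hmid
    have h1 := hbmin _ (hmem 0 (-δ) (by simpa using hδ.le) (by simp [abs_of_pos hδ]))
    simp only [Prod.snd_add, Prod.smul_snd, smul_eq_mul, hyb] at h1
    linarith
  -- Every intermediate row meets the interior of the set.
  have hrow : ∀ h ∈ Set.Ioo b.2 t.2, ∃ y δ : ℝ, 0 < δ ∧ (y - δ, h) ∈ A ∧ (y + δ, h) ∈ A := by
    rintro h ⟨h₁, h₂⟩
    have hpos : 0 < t.2 - b.2 := by linarith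
    have hmem := hsc hb ht hbt_ne (a := (t.2 - h) / (t.2 - b.2)) (b := (h - b.2) / (t.2 - b.2))
      (div_pos (by linarith) hpos) (div_pos (by linarith) hpos) (by field_simp; ring)
    obtain ⟨δ, hδ, hmem⟩ := exists_pos_forall_add_mem_of_mem_interior hmem
    have h1 := hmem (-δ) 0 (by simp [abs_of_pos hδ]) (by simpa using hδ.le)
    have h2 := hmem δ 0 (by simp [abs_of_pos hδ]) (by simpa using hδ.le)
    have hheight : ((t.2 - h) / (t.2 - b.2)) * b.2 + ((h - b.2) / (t.2 - b.2)) * t.2 + 0 = h := by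
      field_simp
      ring
    simp only [Prod.snd_add, Prod.smul_snd, smul_eq_mul, hheight] at h1 h2
    exact ⟨_, δ, hδ, h1, h2⟩
  set R : ℝ → ℝ := fun h => sSup {y : ℝ | (y, h) ∈ A} with hR
  set P : ℝ → ℝ := fun h => sInf {y : ℝ | (y, h) ∈ A} with hP
  have hrow_ne : ∀ h ∈ Set.Ioo b.2 t.2, {y : ℝ | (y, h) ∈ A}.Nonempty := fun h hh => by
    obtain ⟨y, δ, -, h1, -⟩ := hrow h hh
    exact ⟨_, h1⟩
  have hRmem : ∀ h ∈ Set.Ioo b.2 t.2, (R h, h) ∈ A := fun h hh =>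
    (isCompact_row hcpt h).sSup_mem (hrow_ne h hh)
  have hPmem : ∀ h ∈ Set.Ioo b.2 t.2, (P h, h) ∈ A := fun h hh =>
    (isCompact_row hcpt h).sInf_mem (hrow_ne h hh)
  have hleR : ∀ y h, (y, h) ∈ A → y ≤ R h := fun y h hy =>
    le_csSup (isCompact_row hcpt h).bddAbove hy
  have hPle : ∀ y h, (y, h) ∈ A → P h ≤ y := fun y h hy =>
    csInf_le (isCompact_row hcpt h).bddBelow hy
  have hPR : ∀ h ∈ Set.Ioo b.2 t.2, P h < R h := fun h hh => by
    obtain ⟨y, δ, hδ, h1, h2⟩ := hrow h hh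
    have := hPle _ _ h1
    have := hleR _ _ h2
    linarith
  have hRcont : ContinuousOn R (Set.Ioo b.2 t.2) := by
    refine ConcaveOn.continuousOn isOpen_Ioo ⟨convex_Ioo _ _, ?_⟩
    intro h₁ hh₁ h₂ hh₂ a c ha hc hac
    exact hleR _ _ (hconv (hRmem h₁ hh₁) (hRmem h₂ hh₂) ha hc hac)
  have hPcont : ContinuousOn P (Set.Ioo b.2 t.2) := by
    refine ConvexOn.continuousOn isOpen_Ioo ⟨convex_Ioo _ _, ?_⟩
    intro h₁ hh₁ h₂ hh₂ a c ha hc hac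
    exact hPle _ _ (hconv (hPmem h₁ hh₁) (hPmem h₂ hh₂) ha hc hac)
  have hRfr : ∀ h ∈ Set.Ioo b.2 t.2, (R h, h) ∈ frontier A := fun h hh => by
    rw [hcl.frontier_eq]
    refine ⟨hRmem h hh, fun hint => ?_⟩
    obtain ⟨δ, hδ, hmem⟩ := exists_pos_forall_add_mem_of_mem_interior hint
    have := hmem δ 0 (by simp [abs_of_pos hδ]) (by simpa using hδ.le)
    simp only [add_zero] at this
    have := hleR _ _ this
    linarith
  have hPfr : ∀ h ∈ Set.Ioo b.2 t.2, (P h, h) ∈ frontier A := fun h hh => by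
    rw [hcl.frontier_eq]
    refine ⟨hPmem h hh, fun hint => ?_⟩
    obtain ⟨δ, hδ, hmem⟩ := exists_pos_forall_add_mem_of_mem_interior hint
    have := hmem (-δ) 0 (by simp [abs_of_pos hδ]) (by simpa using hδ.le)
    simp only [add_zero] at this
    have := hPle _ _ this
    linarith
  set z : ℝ → ℝ × ℝ := fun h => (P h, h + (R h - P h)) with hz
  have hzcont : ContinuousOn z (Set.Ioo b.2 t.2) :=
    hPcont.prodMk (continuousOn_id.add (hRcont.sub hPcont))
  -- For high chords the third vertex lies above the set.
  have hzout : ∃ h ∈ Set.Ioo b.2 t.2, z h ∉ A := by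
    obtain ⟨ε₁, hε₁, h₁⟩ := htop t ht htmax (-1, -1) (by norm_num)
    obtain ⟨ε₂, hε₂, h₂⟩ := htop t ht htmax (1, -1) (by norm_num)
    set ε := min (min ε₁ ε₂) ((t.2 - b.2) / 2) with hε
    have hε0 : 0 < ε := lt_min (lt_min hε₁ hε₂) (by linarith)
    have hεt : ε ≤ (t.2 - b.2) / 2 := min_le_right _ _
    have h₁' := hconv.add_smul_mem_of_le (s := ε) ht h₁ hε0.le
      ((min_le_left _ _).trans (min_le_left _ _)) hε₁
    have h₂' := hconv.add_smul_mem_of_le (s := ε) ht h₂ hε0.le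
      ((min_le_left _ _).trans (min_le_right _ _)) hε₂
    refine ⟨t.2 + ε * (-1), ⟨by linarith, by linarith⟩, fun hmem => ?_⟩
    have k₁ := hPle _ _ h₁'
    have k₂ := hleR _ _ h₂'
    have k₃ := htmax _ hmem
    simp only [Prod.smul_snd, smul_eq_mul, Prod.smul_fst, hz] at k₁ k₂ k₃
    linarith
  -- For low chords the third vertex lies in the set.
  have hzin : ∃ h ∈ Set.Ioo b.2 t.2, z h ∈ A := by
    obtain ⟨ε₁, hε₁, h₁⟩ := hbot b hb hbmin (-2, 1) (by norm_num)
    obtain ⟨ε₂, hε₂, h₂⟩ := hbot b hb hbmin (1, 1) (by norm_num)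
    set ε := min ε₁ ε₂ with hε
    have hε0 : 0 < ε := lt_min hε₁ hε₂
    have hleft : ∀ s, 0 ≤ s → s ≤ ε → b + s • ((-2, 1) : ℝ × ℝ) ∈ A := fun s hs hsε =>
      hconv.add_smul_mem_of_le hb h₁ hs (hsε.trans (min_le_left _ _)) hε₁
    have hright : ∀ s, 0 ≤ s → s ≤ ε → b + s • ((1, 1) : ℝ × ℝ) ∈ A := fun s hs hsε =>
      hconv.add_smul_mem_of_le hb h₂ hs (hsε.trans (min_le_right _ _)) hε₂
    obtain ⟨h₀, hh₀, hnear⟩ : ∃ h₀ > b.2, ∀ y ∈ A, y.2 < h₀ → dist y b < ε / 4 := by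
      have hK : IsCompact (A ∩ {y | ε / 4 ≤ dist y b}) :=
        hcpt.inter_right (isClosed_le continuous_const (continuous_id.dist continuous_const))
      rcases (A ∩ {y | ε / 4 ≤ dist y b}).eq_empty_or_nonempty with hem | hneK
      · refine ⟨b.2 + 1, by linarith, fun y hy _ => ?_⟩
        by_contra! hfar
        have : y ∈ A ∩ {y | ε / 4 ≤ dist y b} := ⟨hy, hfar⟩
        rw [hem] at this
        exact this
      · obtain ⟨k, hk, hkmin⟩ := hK.exists_isMinOn hneK continuous_snd.continuousOn
        refine ⟨k.2, lt_of_le_of_ne (hbmin k hk.1) fun heq => ?_, fun y hy hyk => ?_⟩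
        · have hkb := hbuniq k hk.1 heq.symm
          have := hk.2
          rw [hkb] at this
          simp only [Set.mem_ofPred_eq, dist_self] at this
          linarith
        · by_contra! hfar
          exact (hkmin (⟨hy, hfar⟩ : y ∈ A ∩ {y | ε / 4 ≤ dist y b})).not_gt hyk
    obtain ⟨h, hbh, hlt⟩ := exists_between (show b.2 < min (min h₀ (b.2 + ε / 4)) t.2 from
      lt_min (lt_min hh₀ (by linarith)) hbt)
    rw [lt_min_iff, lt_min_iff] at hlt
    obtain ⟨⟨hlt₀, hltε⟩, hltt⟩ := hlt
    have hh : h ∈ Set.Ioo b.2 t.2 := ⟨hbh, hltt⟩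
    have k₁ := hleft (h - b.2) (by linarith) (by linarith)
    have k₂ := hright (h - b.2) (by linarith) (by linarith)
    have e₁ : b + (h - b.2) • ((-2, 1) : ℝ × ℝ) = (b.1 - 2 * (h - b.2), h) := by
      ext <;> simp; ring
    have e₂ : b + (h - b.2) • ((1, 1) : ℝ × ℝ) = (b.1 + (h - b.2), h) := by
      ext <;> simp
    rw [e₁] at k₁
    rw [e₂] at k₂
    have j₁ := hPle _ _ k₁
    have j₂ := hleR _ _ k₂
    have d₁ := hnear _ (hPmem h hh) hlt₀
    have d₂ := hnear _ (hRmem h hh) hlt₀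
    rw [Prod.dist_eq, max_lt_iff, Real.dist_eq, abs_lt] at d₁ d₂
    simp only at d₁ d₂
    have hPRh := hPR h hh
    have l₁ := hleft (h - b.2 + (R h - P h)) (by linarith) (by linarith)
    have l₂ := hright (h - b.2 + (R h - P h)) (by linarith) (by linarith)
    have e₃ : b + (h - b.2 + (R h - P h)) • ((-2, 1) : ℝ × ℝ)
        = (b.1 - 2 * (h - b.2 + (R h - P h)), h + (R h - P h)) := by
      ext <;> simp <;> ring
    have e₄ : b + (h - b.2 + (R h - P h)) • ((1, 1) : ℝ × ℝ)
        = (b.1 + (h - b.2 + (R h - P h)), h + (R h - P h)) := by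
      ext <;> simp; ring
    rw [e₃] at l₁
    rw [e₄] at l₂
    exact ⟨h, hh, hconv.mem_of_mem_of_mem_row l₁ l₂ (by linarith) (by linarith)⟩
  suffices ∃ h ∈ Set.Ioo b.2 t.2, z h ∈ frontier A by
    obtain ⟨h, hh, hzfr⟩ := this
    refine ⟨P h, h, R h - P h, sub_pos.2 (hPR h hh), hPfr h hh, ?_, hzfr⟩
    rw [add_sub_cancel]
    exact hRfr h hh
  by_contra! hno
  obtain ⟨h₁, hh₁, hin⟩ := hzin
  obtain ⟨h₂, hh₂, hout⟩ := hzout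
  have hpre : IsPreconnected (z '' Set.Ioo b.2 t.2) := isPreconnected_Ioo.image z hzcont
  have hmem_int : ∀ h ∈ Set.Ioo b.2 t.2, z h ∈ A → z h ∈ interior A := fun h hh hA => by
    by_contra hni
    refine hno h hh ?_
    rw [hcl.frontier_eq]
    exact ⟨hA, hni⟩
  have hsub : z '' Set.Ioo b.2 t.2 ⊆ interior A := hpre.subset_left_of_subset_union isOpen_interior hcl.isOpen_compl
    (disjoint_compl_right.mono_left interior_subset)
    (by
      rintro _ ⟨h, hh, rfl⟩
      by_cases hA : z h ∈ A
      · exact Or.inl (hmem_int h hh hA)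
      · exact Or.inr hA)
    ⟨z h₁, ⟨h₁, hh₁, rfl⟩, hmem_int h₁ hh₁ hin⟩
  exact hout (interior_subset (hsub ⟨h₂, hh₂, rfl⟩))

end InscribedTriangle

section Ranges

lemma exists_coordinates {f : Pt →ₗ[ℝ] ℝ} {d e : Pt} (hd : d ≠ 0) (hfd : f d = 0)
    (hfe : f e ≠ 0) : ∃ Φ : (ℝ × ℝ) ≃L[ℝ] Pt, ∀ z, Φ z = z.1 • d + z.2 • e := by
  let φ : ℝ × ℝ →ₗ[ℝ] Pt :=
    (LinearMap.toSpanSingleton ℝ Pt d).coprod (LinearMap.toSpanSingleton ℝ Pt e)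
  have hφ : ∀ z, φ z = z.1 • d + z.2 • e := fun z => by simp [φ]
  have hinj : Function.Injective φ := by
    rw [injective_iff_map_eq_zero]
    intro z hz
    rw [hφ] at hz
    have h2 : z.2 = 0 := by
      have := congrArg f hz
      simpa [hfd, hfe] using this
    rw [h2, zero_smul, add_zero, smul_eq_zero] at hz
    exact Prod.ext (hz.resolve_right hd) h2
  refine ⟨(φ.linearEquivOfInjective hinj (by simp)).toContinuousLinearEquiv, fun z => ?_⟩
  rw [← hφ]
  rfl

lemma exists_smul_add_smul_eq {f : Pt →ₗ[ℝ] ℝ} {d e : Pt} (hd : d ≠ 0) (hfd : f d = 0)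
    (hfe : f e ≠ 0) (y : Pt) : ∃ u t : ℝ, y = u • d + t • e := by
  obtain ⟨Φ, hΦ⟩ := exists_coordinates hd hfd hfe
  exact ⟨(Φ.symm y).1, (Φ.symm y).2, by rw [← hΦ, Φ.apply_symm_apply]⟩

/-- Every triangle has a positively homothetic copy inscribed in a given nice shape. -/
lemma NiceShape.exists_inscribed_triangle_s12 {S : Set Pt} (hS : NiceShape S) {f : Pt →ₗ[ℝ] ℝ}
    {d e : Pt} (hd : d ≠ 0) (hfd : f d = 0) (hfe : f e ≠ 0) :
    ∃ (z : Pt) (c : ℝ), 0 < c ∧ z ∈ frontier S ∧ z + c • d ∈ frontier S ∧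
      z + c • e ∈ frontier S := by
  obtain ⟨Φ, hΦ⟩ := exists_coordinates hd hfd hfe
  let g : Pt →ₗ[ℝ] ℝ := (LinearMap.snd ℝ ℝ ℝ).comp Φ.symm.toLinearEquiv.toLinearMap
  have hg : ∀ z, g (Φ z) = z.2 := fun z => by simp [g]
  have hg0 : g ≠ 0 := fun h => by
    have := hg (0, 1)
    rw [h] at this
    simp at this
  have hfr : Φ ⁻¹' frontier S = frontier (Φ ⁻¹' S) := Φ.toHomeomorph.preimage_frontier S
  have hint : Φ ⁻¹' interior S = interior (Φ ⁻¹' S) := Φ.toHomeomorph.preimage_interior S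
  obtain ⟨l, h, c, hc, h₁, h₂, h₃⟩ := exists_inscribed_right_triangle (A := Φ ⁻¹' S)
    (hS.strictConvex.linear_preimage Φ.toLinearEquiv.toLinearMap Φ.continuous Φ.injective)
    (Φ.toHomeomorph.isCompact_preimage.2 hS.2.2.1)
    (by
      rw [← hint]
      exact hS.interior_nonempty_s12.preimage Φ.surjective)
    (fun b hb hmin w hw => by
      obtain ⟨ε, hε, hmem⟩ := hS.exists_add_smul_mem hg0 (b := Φ b) (w := Φ w) hb
        (fun y hy => by
          have := hmin (Φ.symm y) (by simpa using hy)
          rw [← hg, ← hg, Φ.apply_symm_apply] at this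
          exact this)
        (by rwa [hg])
      exact ⟨ε, hε, by simpa using hmem⟩)
    (fun b hb hmax w hw => by
      obtain ⟨ε, hε, hmem⟩ := hS.exists_add_smul_mem (neg_ne_zero.2 hg0) (b := Φ b) (w := Φ w) hb
        (fun y hy => by
          have := hmax (Φ.symm y) (by simpa using hy)
          rw [← hg, ← hg, Φ.apply_symm_apply] at this
          exact neg_le_neg this)
        (by
          rw [LinearMap.neg_apply, hg]
          linarith)
      exact ⟨ε, hε, by simpa using hmem⟩)
  rw [← hfr, Set.mem_preimage, hΦ] at h₁ h₂ h₃
  refine ⟨l • d + h • e, c, hc, h₁, ?_, ?_⟩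
  · convert h₂ using 1
    module
  · convert h₃ using 1
    module

/-- The homeomorphism `x ↦ c • x + v` of the plane. -/
def scaleTranslate (c : ℝ) (hc : c ≠ 0) (v : Pt) : Pt ≃ₜ Pt :=
  (Homeomorph.smulOfNeZero c hc).trans (Homeomorph.addRight v)

lemma interior_preimage_smul_add {c : ℝ} (hc : c ≠ 0) (v : Pt) (S : Set Pt) :
    interior ((fun x => c • x + v) ⁻¹' S) = (fun x => c • x + v) ⁻¹' interior S :=
  ((scaleTranslate c hc v).preimage_interior S).symm

lemma frontier_preimage_smul_add {c : ℝ} (hc : c ≠ 0) (v : Pt) (S : Set Pt) :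
    frontier ((fun x => c • x + v) ⁻¹' S) = (fun x => c • x + v) ⁻¹' frontier S :=
  ((scaleTranslate c hc v).preimage_frontier S).symm

lemma image_smul_add_eq_preimage {c : ℝ} (hc : c ≠ 0) (v : Pt) (S : Set Pt) :
    (fun x => c • x + v) '' S = (fun x => c⁻¹ • x + -(c⁻¹ • v)) ⁻¹' S := by
  ext y
  constructor
  · rintro ⟨x, hx, rfl⟩
    simpa [smul_smul, hc] using hx
  · intro hy
    exact ⟨_, hy, by simp [smul_smul, hc]⟩

lemma isRange_iff_eq_preimage {S T : Set Pt} :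
    IsRange S T ↔ ∃ (c : ℝ) (v : Pt), 0 < c ∧ T = (fun x => c • x + v) ⁻¹' S := by
  constructor
  · rintro ⟨c, v, hc, rfl⟩
    exact ⟨_, _, inv_pos.2 hc, image_smul_add_eq_preimage hc.ne' v S⟩
  · rintro ⟨c, v, hc, rfl⟩
    refine ⟨c⁻¹, -(c⁻¹ • v), inv_pos.2 hc, ?_⟩
    rw [image_smul_add_eq_preimage (inv_ne_zero hc.ne')]
    simp [smul_smul, hc.ne']

lemma IsRange.symm {S T : Set Pt} (h : IsRange S T) : IsRange T S := by
  obtain ⟨c, v, hc, rfl⟩ := isRange_iff_eq_preimage.1 h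
  refine ⟨c, v, hc, ?_⟩
  rw [Set.image_preimage_eq]
  exact (scaleTranslate c hc.ne' v).surjective

lemma IsRange.trans {S T U : Set Pt} (hST : IsRange S T) (hTU : IsRange T U) : IsRange S U := by
  obtain ⟨c, v, hc, rfl⟩ := hST
  obtain ⟨c', v', hc', rfl⟩ := hTU
  refine ⟨c' * c, c' • v + v', mul_pos hc' hc, ?_⟩
  rw [Set.image_image]
  refine Set.image_congr fun x _ => ?_
  module

lemma IsRange.isCompact {S T : Set Pt} (h : IsRange S T) (hS : IsCompact S) : IsCompact T := by
  obtain ⟨c, v, -, rfl⟩ := h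
  exact hS.image (by fun_prop)

lemma IsRange.strictConvex {S T : Set Pt} (h : IsRange S T) (hS : StrictConvex ℝ S) :
    StrictConvex ℝ T := by
  obtain ⟨c, v, hc, rfl⟩ := isRange_iff_eq_preimage.1 h
  intro x hx y hy hxy a b ha hb hab
  rw [interior_preimage_smul_add hc.ne']
  have := hS hx hy (fun he => hxy ((scaleTranslate c hc.ne' v).injective he)) ha hb hab
  have hv : v = (a + b) • v := by rw [hab, one_smul]
  have heq : c • (a • x + b • y) + v = a • (c • x + v) + b • (c • y + v) := by
    conv_lhs => rw [hv]
    module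
  rw [Set.mem_preimage, heq]
  exact this

section StrictlyConvex

variable {T : Set Pt}

lemma StrictConvex.add_smul_mem_interior (hT : StrictConvex ℝ T) {z d : Pt} (hd : d ≠ 0)
    {a b c : ℝ} (hab : a < b) (hbc : b < c) (ha : z + a • d ∈ T) (hc : z + c • d ∈ T) :
    z + b • d ∈ interior T := by
  have hpos : 0 < c - a := by linarith
  have hne : z + a • d ≠ z + c • d := fun h => by
    have := smul_left_injective ℝ hd (add_left_cancel h)
    linarith
  have := hT ha hc hne (a := (c - b) / (c - a)) (b := (b - a) / (c - a))
    (div_pos (by linarith) hpos) (div_pos (by linarith) hpos) (by field_simp; ring)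
  convert this using 1
  match_scalars <;> field_simp <;> ring

/-- A line meets the boundary of a strictly convex set in at most two points. -/
lemma StrictConvex.eq_zero_or_one_of_mem_frontier (hT : StrictConvex ℝ T) (hcl : IsClosed T)
    {z d : Pt} (hd : d ≠ 0) {s : ℝ} (hz : z ∈ frontier T) (hzd : z + d ∈ frontier T)
    (hs : z + s • d ∈ frontier T) : s = 0 ∨ s = 1 := by
  rw [hcl.frontier_eq] at hz hzd hs
  have e0 : z + (0 : ℝ) • d = z := by simp
  have e1 : z + (1 : ℝ) • d = z + d := by simp
  rw [← e0] at hz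
  rw [← e1] at hzd
  rcases lt_trichotomy s 0 with h0 | h0 | h0
  · exact absurd (hT.add_smul_mem_interior hd h0 one_pos hs.1 hzd.1) hz.2
  · exact Or.inl h0
  · rcases lt_trichotomy s 1 with h1 | h1 | h1
    · exact absurd (hT.add_smul_mem_interior hd h0 h1 hz.1 hzd.1) hs.2
    · exact Or.inr h1
    · exact absurd (hT.add_smul_mem_interior hd one_pos h1 hz.1 hs.1) hzd.2

lemma StrictConvex.eq_or_eq_of_mem_frontier (hT : StrictConvex ℝ T) (hcl : IsClosed T)
    {f : Pt →ₗ[ℝ] ℝ} (hf : f ≠ 0) {p q x : Pt} (hpq : p ≠ q) (hq : f q = f p) (hx : f x = f p)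
    (hpT : p ∈ frontier T) (hqT : q ∈ frontier T) (hxT : x ∈ frontier T) : x = p ∨ x = q := by
  obtain ⟨e, he⟩ : ∃ e, f e ≠ 0 := by
    by_contra! h
    exact hf (LinearMap.ext h)
  have hd : q - p ≠ 0 := sub_ne_zero.2 hpq.symm
  have hfd : f (q - p) = 0 := by rw [map_sub, hq, sub_self]
  obtain ⟨s, t, hst⟩ := exists_smul_add_smul_eq hd hfd he (x - p)
  have ht : t = 0 := by
    have := congrArg f hst
    rw [map_sub, hx, sub_self, map_add, map_smul, map_smul, hfd] at this
    simpa [he] using this.symm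
  have hx' : x = p + s • (q - p) := by
    rw [ht, zero_smul, add_zero] at hst
    rw [← hst]
    abel
  rcases hT.eq_zero_or_one_of_mem_frontier hcl hd hpT (by simpa using hqT) (hx' ▸ hxT) with h | h
  · left
    simp [hx', h]
  · right
    simp [hx', h]

/-- Let `z`, `z + d` and `z - e`, `z - e + c • d` span two parallel chords of a strictly convex
set, the second below the first.  The homothety mapping the first chord to the second maps every
point of the set above the first chord into the interior of the set. -/
lemma StrictConvex.homothety_mem_interior (hT : StrictConvex ℝ T) {f : Pt →ₗ[ℝ] ℝ} {z d e : Pt}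
    {c u t : ℝ} (hd : d ≠ 0) (hfd : f d = 0) (hfe : f e ≠ 0) (hc : 0 < c) (ht : 0 < t)
    (hz : z ∈ T \ interior T) (hzd : z + d ∈ T \ interior T) (hze : z - e ∈ T)
    (hzed : z - e + c • d ∈ T) (hx : z + (u • d + t • e) ∈ T) :
    z - e + c • (u • d + t • e) ∈ interior T := by
  have ht1 : 0 < 1 + t := by linarith
  have hsum : 1 / (1 + t) + t / (1 + t) = 1 := by field_simp
  have hne : ∀ k : ℝ, z + (u • d + t • e) ≠ z - e + k • d := fun k h => by
    have := congrArg f h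
    simp only [map_add, map_sub, map_smul, hfd, smul_eq_mul, mul_zero, zero_add, add_zero] at this
    have h0 : (1 + t) * f e = 0 := by linarith
    rcases mul_eq_zero.1 h0 with h | h
    · linarith
    · exact hfe h
  -- the segments from `x` to the endpoints of the lower chord cross the upper chord
  have hcross : ∀ k : ℝ, z - e + k • d ∈ T → z + ((u + t * k) / (1 + t)) • d ∈ interior T := by
    intro k hk
    have := hT hx hk (hne k) (a := 1 / (1 + t)) (b := t / (1 + t)) (by positivity)
      (by positivity) hsum
    convert this using 1
    match_scalars <;> field_simp
    ring
  have e0 : z + (0 : ℝ) • d = z := by simp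
  have e1 : z + (1 : ℝ) • d = z + d := by simp
  have hu : 0 < u := by
    have hmem := hcross 0 (by simpa using hze)
    rw [mul_zero, add_zero] at hmem
    by_contra! hu
    rcases hu.lt_or_eq with h | h
    · exact hz.2 (e0 ▸ hT.add_smul_mem_interior hd (div_neg_of_neg_of_pos h ht1) one_pos
        (interior_subset hmem) (e1.symm ▸ hzd.1))
    · rw [h, zero_div, e0] at hmem
      exact hz.2 hmem
  have huc : u + t * c < 1 + t := by
    have hmem := hcross c hzed
    by_contra! hge
    rcases hge.lt_or_eq with h | h
    · exact hzd.2 (e1 ▸ hT.add_smul_mem_interior hd one_pos ((one_lt_div ht1).2 h)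
        (e0.symm ▸ hz.1) (interior_subset hmem))
    · rw [← h, div_self ht1.ne', e1] at hmem
      exact hzd.2 hmem
  have htc : 0 < t * c := mul_pos ht hc
  have hden : 0 < 1 + t - t * c := by linarith
  obtain ⟨k, hk, hn⟩ : ∃ k : ℝ, k * (1 + t - t * c) = u * c ∧ z - e + k • d ∈ interior T := by
    refine ⟨u * c / (1 + t - t * c), div_mul_cancel₀ _ hden.ne', ?_⟩
    refine hT.add_smul_mem_interior hd (a := 0) (c := c) (by positivity) ?_
      (by simpa using hze) hzed
    rw [div_lt_iff₀ hden]
    nlinarith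
  have := hT.convex.combo_interior_self_mem_interior hn hx
    (a := (1 + t - t * c) / (1 + t)) (b := t * c / (1 + t)) (by positivity) (by positivity)
    (by field_simp; ring)
  convert this using 1
  match_scalars
  · field_simp
    ring
  · field_simp
    ring
  · field_simp
    linear_combination -hk

end StrictlyConvex

/-- `T` precedes `T'` in the order of ranges through two points on the line `f = a`: above the line
`T` lies inside `T'` and below the line `T'` lies inside `T`. -/
def Precedes (f : Pt →ₗ[ℝ] ℝ) (a : ℝ) (T T' : Set Pt) : Prop :=
  (∀ x ∈ T, a < f x → x ∈ interior T') ∧ ∀ x ∈ T', f x < a → x ∈ interior T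

variable {f : Pt →ₗ[ℝ] ℝ} {a : ℝ} {p q : Pt} {T T' : Set Pt}

lemma mem_interior_preimage_of_lt (hT : StrictConvex ℝ T) (hcl : IsClosed T) (hpq : p ≠ q)
    (hp : f p = a) (hq : f q = a) {c : ℝ} {v : Pt} (hc : 0 < c) (hpT : p ∈ frontier T)
    (hqT : q ∈ frontier T) (hpT' : c • p + v ∈ T) (hqT' : c • q + v ∈ T)
    (hlt : f (c • p + v) < a) {x : Pt} (hx : x ∈ T) (hax : a < f x) :
    x ∈ interior ((fun x => c • x + v) ⁻¹' T) := by
  rw [interior_preimage_smul_add hc.ne', Set.mem_preimage]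
  rw [hcl.frontier_eq] at hpT hqT
  have hd : q - p ≠ 0 := sub_ne_zero.2 hpq.symm
  have hfd : f (q - p) = 0 := by rw [map_sub, hq, hp, sub_self]
  have hfe : 0 < f (p - (c • p + v)) := by
    rw [map_sub]
    linarith
  obtain ⟨u, t, hut⟩ := exists_smul_add_smul_eq hd hfd hfe.ne' (x - p)
  have ht : 0 < t := by
    have h := congrArg f hut
    rw [map_sub, map_add, map_smul, map_smul, hfd, smul_zero, zero_add, smul_eq_mul] at h
    exact pos_of_mul_pos_left (by rw [← h]; linarith) hfe.le
  have := hT.homothety_mem_interior (z := p) hd hfd hfe.ne' hc ht hpT (by simpa using hqT)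
    (by simpa using hpT') (by convert hqT' using 1; module) (u := u)
    (by rw [← hut]; simpa using hx)
  rw [← hut] at this
  convert this using 1
  module

lemma precedes_of_lt (hT : StrictConvex ℝ T) (hcl : IsClosed T) (hpq : p ≠ q)
    (hp : f p = a) (hq : f q = a) {c : ℝ} {v : Pt} (hc : 0 < c)
    (hT' : T' = (fun x => c • x + v) ⁻¹' T) (hTinv : T = (fun x => c⁻¹ • x + -(c⁻¹ • v)) ⁻¹' T')
    (hT'sc : StrictConvex ℝ T') (hT'cl : IsClosed T') (hpT : p ∈ frontier T)
    (hqT : q ∈ frontier T) (hpT' : p ∈ frontier T') (hqT' : q ∈ frontier T')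
    (hlt : f (c • p + v) < a) : Precedes f a T T' := by
  constructor
  · intro x hx hax
    have h1 : c • p + v ∈ T := by
      have := hT'cl.frontier_subset hpT'
      rwa [hT'] at this
    have h2 : c • q + v ∈ T := by
      have := hT'cl.frontier_subset hqT'
      rwa [hT'] at this
    rw [hT']
    exact mem_interior_preimage_of_lt hT hcl hpq hp hq hc hpT hqT h1 h2 hlt hx hax
  · intro x hx hax
    have h1 : c⁻¹ • p + -(c⁻¹ • v) ∈ T' := by
      have := hcl.frontier_subset hpT
      rwa [hTinv] at this
    have h2 : c⁻¹ • q + -(c⁻¹ • v) ∈ T' := by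
      have := hcl.frontier_subset hqT
      rwa [hTinv] at this
    rw [hTinv]
    refine mem_interior_preimage_of_lt (f := -f) (a := -a) hT'sc hT'cl hpq (by simp [hp])
      (by simp [hq]) (inv_pos.2 hc) hpT' hqT' h1 h2 ?_ hx (by simpa using hax)
    simp only [map_add, map_smul, smul_eq_mul, map_neg, LinearMap.neg_apply, hp] at hlt ⊢
    have : c⁻¹ * (c * a + f v) < c⁻¹ * a := mul_lt_mul_of_pos_left hlt (inv_pos.2 hc)
    rw [mul_add, inv_mul_cancel_left₀ hc.ne'] at this
    linarith

/-- Any two ranges through `p` and `q` are comparable. -/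
lemma eq_or_precedes_or_precedes {S : Set Pt} (hS : NiceShape S) (hf : f ≠ 0) (hpq : p ≠ q)
    (hp : f p = a) (hq : f q = a) (hT : T ∈ rangesThrough S p q) (hT' : T' ∈ rangesThrough S p q) :
    T = T' ∨ Precedes f a T T' ∨ Precedes f a T' T := by
  obtain ⟨hTr, hpT, hqT⟩ := hT
  obtain ⟨hTr', hpT', hqT'⟩ := hT'
  have hsc := hTr.strictConvex hS.strictConvex
  have hsc' := hTr'.strictConvex hS.strictConvex
  have hcl := (hTr.isCompact hS.2.2.1).isClosed
  have hcl' := (hTr'.isCompact hS.2.2.1).isClosed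
  obtain ⟨c, v, hc, hpre⟩ := isRange_iff_eq_preimage.1 (hTr.symm.trans hTr')
  have hinv : T = (fun x => c⁻¹ • x + -(c⁻¹ • v)) ⁻¹' T' := by
    rw [← image_smul_add_eq_preimage hc.ne', hpre, Set.image_preimage_eq]
    exact (scaleTranslate c hc.ne' v).surjective
  rcases lt_trichotomy (f (c • p + v)) a with h | h | h
  · exact Or.inr (Or.inl (precedes_of_lt hsc hcl hpq hp hq hc hpre hinv hsc' hcl' hpT hqT hpT'
      hqT' h))
  · left
    have hfr : ∀ x ∈ frontier T', c • x + v ∈ frontier T := fun x hx => by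
      rw [hpre, frontier_preimage_smul_add hc.ne'] at hx
      exact hx
    have hp₀ := hfr p hpT'
    have hq₀ := hfr q hqT'
    have hd : q - p ≠ 0 := sub_ne_zero.2 hpq.symm
    have hqT₀ : p + (q - p) ∈ frontier T := by simpa using hqT
    have hqp : c • q + v = c • p + v + c • (q - p) := by module
    rcases hsc.eq_or_eq_of_mem_frontier hcl hf hpq (hq.trans hp.symm) (h.trans hp.symm) hpT hqT hp₀
      with h' | h'
    · rw [hqp, h'] at hq₀
      rcases hsc.eq_zero_or_one_of_mem_frontier hcl hd hpT hqT₀ hq₀ with hc0 | hc1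
      · exact absurd hc0 hc.ne'
      · have hv : v = 0 := by
          rw [hc1, one_smul] at h'
          simpa using h'
        rw [hpre, hc1, hv]
        simp
    · rw [hqp, h'] at hq₀
      have hq₁ : p + (1 + c) • (q - p) ∈ frontier T := by
        convert hq₀ using 1
        module
      rcases hsc.eq_zero_or_one_of_mem_frontier hcl hd hpT hqT₀ hq₁ with h0 | h1 <;> linarith
  · refine Or.inr (Or.inr (precedes_of_lt (c := c⁻¹) (v := -(c⁻¹ • v)) hsc' hcl' hpq hp hq
      (inv_pos.2 hc) hinv ?_ hsc hcl hpT' hqT' hpT hqT ?_))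
    · rw [hpre]
      simp [smul_smul, hc.ne']
    · simp only [map_add, map_smul, smul_eq_mul, map_neg, hp] at h ⊢
      have : c⁻¹ * a < c⁻¹ * (c * a + f v) := mul_lt_mul_of_pos_left h (inv_pos.2 hc)
      rw [mul_add, inv_mul_cancel_left₀ hc.ne'] at this
      linarith

/-- Three points not on a line lie on the boundary of at most one range. -/
lemma rangesThrough_unique {S : Set Pt} (hS : NiceShape S) (hf : f ≠ 0) (hpq : p ≠ q)
    (hp : f p = a) (hq : f q = a) (hT : T ∈ rangesThrough S p q) (hT' : T' ∈ rangesThrough S p q)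
    {x : Pt} (hx : f x ≠ a) (hxT : x ∈ frontier T) (hxT' : x ∈ frontier T') : T = T' := by
  rw [((hT.1.isCompact hS.2.2.1).isClosed).frontier_eq] at hxT
  rw [((hT'.1.isCompact hS.2.2.1).isClosed).frontier_eq] at hxT'
  rcases eq_or_precedes_or_precedes hS hf hpq hp hq hT hT' with h | h | h
  · exact h
  · rcases hx.lt_or_gt with hlt | hgt
    · exact absurd (h.2 x hxT'.1 hlt) hxT.2
    · exact absurd (h.1 x hxT.1 hgt) hxT'.2
  · rcases hx.lt_or_gt with hlt | hgt
    · exact absurd (h.2 x hxT.1 hlt) hxT'.2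
    · exact absurd (h.1 x hxT'.1 hgt) hxT.2

/-- Three points not on a line lie on the boundary of at least one range. -/
lemma exists_rangesThrough_of_ne {S : Set Pt} (hS : NiceShape S) (hpq : p ≠ q)
    (hp : f p = a) (hq : f q = a) {x : Pt} (hx : f x ≠ a) :
    ∃ T ∈ rangesThrough S p q, x ∈ frontier T := by
  obtain ⟨z, c, hc, h₁, h₂, h₃⟩ := hS.exists_inscribed_triangle_s12 (f := f) (d := q - p) (e := x - p)
    (sub_ne_zero.2 hpq.symm) (by rw [map_sub, hp, hq, sub_self])
    (by rwa [map_sub, hp, sub_ne_zero])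
  have hfr := frontier_preimage_smul_add hc.ne' (z - c • p) S
  refine ⟨_, ⟨isRange_iff_eq_preimage.2 ⟨c, z - c • p, hc, rfl⟩, ?_, ?_⟩, ?_⟩ <;>
    rw [hfr, Set.mem_preimage]
  · simpa using h₁
  · convert h₂ using 1
    module
  · convert h₃ using 1
    module

lemma exists_mem_gt_of_mem_interior (hf : f ≠ 0) {m : Pt} (hm : m ∈ interior T) :
    ∃ y ∈ T, f m < f y := by
  obtain ⟨y, hy, hlt⟩ := exists_mem_lt_of_mem_interior (neg_ne_zero.2 hf) hm
  exact ⟨y, hy, by simpa using hlt⟩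

lemma Precedes.inter_ssubset (h : Precedes f a T T') (hf : f ≠ 0) (hT : StrictConvex ℝ T)
    (hcpt : IsCompact T) (hpq : p ≠ q) (hp : f p = a) (hq : f q = a) (hpT : p ∈ T) (hqT : q ∈ T) :
    T ∩ {x | a < f x} ⊂ T' ∩ {x | a < f x} := by
  have hsub : T ∩ {x | a < f x} ⊆ T' ∩ {x | a < f x} := fun x hx =>
    ⟨interior_subset (h.1 x hx.1 hx.2), hx.2⟩
  refine (Set.ssubset_iff_of_subset hsub).2 ?_
  have hmid := hT hpT hqT hpq (a := 1 / 2) (b := 1 / 2) (by norm_num) (by norm_num) (by norm_num)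
  obtain ⟨y₀, hy₀, hlt₀⟩ := exists_mem_gt_of_mem_interior hf hmid
  obtain ⟨y, hy, hymax⟩ := hcpt.exists_isMaxOn ⟨p, hpT⟩
    (LinearMap.continuous_of_finiteDimensional f).continuousOn
  have hay : a < f y := by
    have : f y₀ ≤ f y := hymax hy₀
    simp only [map_add, map_smul, smul_eq_mul, hp, hq] at hlt₀
    linarith
  obtain ⟨y', hy', hlt⟩ := exists_mem_gt_of_mem_interior hf (h.1 y hy hay)
  exact ⟨y', ⟨hy', hay.trans hlt⟩, fun hmem => (show f y' ≤ f y from hymax hmem.1).not_gt hlt⟩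

/-- No point of the line `f = a` is interior to the symmetric difference of the half-plane above
this line and a strictly convex set with a chord on it. -/
lemma mem_interior_symmDiff_ne (hf : f ≠ 0) (hT : StrictConvex ℝ T) (hpq : p ≠ q) (hp : f p = a)
    (hq : f q = a) (hpT : p ∈ T) (hqT : q ∈ T) {x : Pt}
    (hx : x ∈ interior ((T \ {y | a < f y}) ∪ ({y | a < f y} \ T))) : f x ≠ a := by
  intro hxa
  have hxT : x ∈ T := by
    rcases interior_subset hx with h | h
    · exact h.1
    · exact absurd h.1 hxa.not_gt
  obtain ⟨r, hr, hra, hxr⟩ : ∃ r ∈ T, f r = a ∧ x ≠ r := by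
    by_cases h : x = p
    · exact ⟨q, hqT, hq, h ▸ hpq⟩
    · exact ⟨p, hpT, hp, h⟩
  have hcont : Filter.Tendsto (fun t : ℝ => (1 - t) • x + t • r) (nhdsWithin 0 (Set.Ioi 0))
      (nhds x) := by
    have : Continuous fun t : ℝ => (1 - t) • x + t • r := by fun_prop
    have h := (this.tendsto 0).mono_left (nhdsWithin_le_nhds (s := Set.Ioi 0))
    simpa using h
  obtain ⟨t, htmem, ht⟩ := ((hcont.eventually (isOpen_interior.mem_nhds hx)).and
    (Ioo_mem_nhdsGT (one_pos : (0 : ℝ) < 1))).exists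
  have hint := hT hxT hr hxr (a := 1 - t) (b := t) (by linarith [ht.2]) ht.1 (by ring)
  obtain ⟨y, hy, hlt⟩ := exists_mem_gt_of_mem_interior hf
    (T := interior ((T \ {y | a < f y}) ∪ ({y | a < f y} \ T)) ∩ interior T)
    (m := (1 - t) • x + t • r)
    (by
      rw [(isOpen_interior.inter isOpen_interior).interior_eq]
      exact ⟨htmem, hint⟩)
  have hya : a < f y := by
    simp only [map_add, map_smul, smul_eq_mul, hxa, hra] at hlt
    linarith
  rcases interior_subset hy.1 with h | h
  · exact h.2 hya
  · exact h.2 (interior_subset hy.2)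

end Ranges

/-- there is a `≺`-minimal range in `𝒮_pq` strictly after `S₁`
having a new point of `X` on its boundary if and only if the interior of the
symmetric difference `S₁ △ L` contains a point of `X`. -/
theorem next_range_exists_iff
    (S : Set Pt) (hS : NiceShape S) (X : Finset Pt)
    (p q : Pt) (hpq : p ≠ q)
    (h4 : NoFourOnBoundary S (↑X ∪ {p, q}))
    (L : Set Pt) (hL : IsOpenHalfplaneOf p q L)
    (S₁ : Set Pt) (hS₁ : S₁ ∈ rangesThrough S p q) :
    (∃ S₂ ∈ nextCandidates S p q L X S₁,
        ∀ S₃ ∈ nextCandidates S p q L X S₁, ¬ (S₃ ∩ L ⊂ S₂ ∩ L)) ↔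
      ∃ x ∈ X, x ∈ interior ((S₁ \ L) ∪ (L \ S₁)) := by
  obtain ⟨f, a, hf, hp, hq, rfl⟩ := hL
  have hfcont : Continuous f := LinearMap.continuous_of_finiteDimensional f
  obtain ⟨hr₁, hpS₁, hqS₁⟩ := hS₁
  have hcpt₁ := hr₁.isCompact hS.2.2.1
  have hcl₁ := hcpt₁.isClosed
  have hsc₁ := hr₁.strictConvex hS.strictConvex
  have hpS₁' := hcl₁.frontier_subset hpS₁
  have hqS₁' := hcl₁.frontier_subset hqS₁
  have hoff : ∀ T ∈ rangesThrough S p q, ∀ x ∈ frontier T \ frontier S₁, f x ≠ a := by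
    rintro T ⟨hT, hpT, hqT⟩ x ⟨hxT, hxS₁⟩ hx
    rcases (hT.strictConvex hS.strictConvex).eq_or_eq_of_mem_frontier
      (hT.isCompact hS.2.2.1).isClosed hf hpq (hq.trans hp.symm) (hx.trans hp.symm) hpT hqT hxT
      with rfl | rfl
    · exact hxS₁ hpS₁
    · exact hxS₁ hqS₁
  constructor
  · rintro ⟨S₂, ⟨hS₂, hsub, x, hx, hxX⟩, -⟩
    refine ⟨x, hxX, ?_⟩
    have hcl₂ := (hS₂.1.isCompact hS.2.2.1).isClosed
    have hpre : Precedes f a S₁ S₂ := by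
      rcases eq_or_precedes_or_precedes hS hf hpq hp hq ⟨hr₁, hpS₁, hqS₁⟩ hS₂ with h | h | h
      · rw [h] at hsub
        exact absurd hsub (ssubset_irrefl _)
      · exact h
      · exact absurd (fun y hy => ⟨interior_subset (h.1 y hy.1 hy.2), hy.2⟩) hsub.2
    have hx₂ := hx.1
    rw [hcl₂.frontier_eq] at hx₂
    rcases (hoff S₂ hS₂ x hx).lt_or_gt with hlt | hgt
    · refine interior_maximal (t := interior S₁ ∩ {y | f y < a}) ?_
        (isOpen_interior.inter (isOpen_lt hfcont continuous_const))
        ⟨hpre.2 x hx₂.1 hlt, hlt⟩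
      exact fun y hy => Or.inl ⟨interior_subset hy.1, fun h =>
        (show f y < a from hy.2).not_gt h⟩
    · refine interior_maximal (t := {y | a < f y} \ S₁) (fun y hy => Or.inr hy)
        ((isOpen_lt continuous_const hfcont).sdiff hcl₁)
        ⟨hgt, fun h => hx₂.2 (hpre.1 x h hgt)⟩
  · rintro ⟨x, hxX, hx⟩
    have hxa : f x ≠ a := mem_interior_symmDiff_ne hf hsc₁ hpq hp hq hpS₁' hqS₁' hx
    have hxS₁ : (f x < a ∧ x ∈ interior S₁) ∨ (a < f x ∧ x ∉ S₁) := by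
      rcases hxa.lt_or_gt with hlt | hgt
      · refine Or.inl ⟨hlt, interior_maximal
          (t := interior ((S₁ \ {y | a < f y}) ∪ ({y | a < f y} \ S₁)) ∩ {y | f y < a}) ?_
          (isOpen_interior.inter (isOpen_lt hfcont continuous_const)) ⟨hx, hlt⟩⟩
        rintro y ⟨hy, hya⟩
        rcases interior_subset hy with h | h
        · exact h.1
        · exact absurd h.1 (show f y < a from hya).not_gt
      · rcases interior_subset hx with h | h
        · exact absurd hgt h.2
        · exact Or.inr ⟨hgt, h.2⟩
    have hfin : (nextCandidates S p q {y | a < f y} X S₁).Finite := by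
      refine (X.finite_toSet.biUnion (t := fun y =>
        {T | T ∈ rangesThrough S p q ∧ y ∈ frontier T ∧ f y ≠ a}) fun y _ => ?_).subset ?_
      · exact Set.Subsingleton.finite fun T hT T' hT' =>
          rangesThrough_unique hS hf hpq hp hq hT.1 hT'.1 hT.2.2 hT.2.1 hT'.2.1
      · rintro T ⟨hT, -, y, hy, hyX⟩
        exact Set.mem_biUnion hyX ⟨hT, hy.1, hoff T hT y hy⟩
    have hne : (nextCandidates S p q {y | a < f y} X S₁).Nonempty := by
      obtain ⟨T, hT, hxT⟩ := exists_rangesThrough_of_ne hS hpq hp hq hxa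
      have hxT' := hxT
      rw [(hT.1.isCompact hS.2.2.1).isClosed.frontier_eq] at hxT'
      have hxfr : x ∉ frontier S₁ := by
        rw [hcl₁.frontier_eq]
        rintro ⟨h, h'⟩
        rcases hxS₁ with hx | hx
        · exact h' hx.2
        · exact hx.2 h
      refine ⟨T, hT, Precedes.inter_ssubset ?_ hf hsc₁ hcpt₁ hpq hp hq hpS₁' hqS₁',
        x, ⟨hxT, hxfr⟩, hxX⟩
      rcases eq_or_precedes_or_precedes hS hf hpq hp hq ⟨hr₁, hpS₁, hqS₁⟩ hT with h | h | h
      · rw [h] at hxfr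
        exact absurd hxT hxfr
      · exact h
      · rcases hxS₁ with ⟨hlt, hin⟩ | ⟨hgt, hout⟩
        · exact absurd (h.2 x (interior_subset hin) hlt) hxT'.2
        · exact absurd (interior_subset (h.1 x hxT'.1 hgt)) hout
    obtain ⟨S₂, hS₂, hmin⟩ := hfin.exists_minimalFor (fun T => T ∩ {y | a < f y}) _ hne
    exact ⟨S₂, hS₂, fun S₃ hS₃ hlt => hlt.2 (hmin hS₃ hlt.1)⟩
end
end
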